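/- arXiv:1307.0369 — 2 statements merged into one kernel-verified Lean document; each statement's English description precedes it below -/
import Mathlib

section
/- Let φ: (R, m) → (S, n) be a flat local ring homomorphism of commutative noetherian local rings (i.e., φ makes S into a flat R-module and mS ⊆ n). Then S is Gorenstein if and only if both R and the closed fibre S/mS are Gorenstein. -/
/-!
STATEMENT 0: Let φ: (R,m) → (S,n) be a flat local homomorphism of commutative
noetherian local rings. Then S is Gorenstein iff R and the closed fibre S/mS
are Gorenstein.
-/

open CategoryTheory

/-- `Ext^i_R(M, N)` for `R`-modules `M`, `N`. -/
noncomputable def extMod (R : Type) [CommRing R] (M N : ModuleCat R) (i : ℕ) : ModuleCat R :=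
  ((Ext R (ModuleCat R) i).obj (Opposite.op M)).obj N

/-- A commutative ring is Gorenstein if it has finite injective dimension as a module over
itself, i.e. there is `n` such that `Ext^i_R(M, R) = 0` for all modules `M` and all `i > n`. -/
def IsGorenstein (R : Type) [CommRing R] : Prop :=
  ∃ n : ℕ, ∀ (M : ModuleCat R) (i : ℕ), n < i → Subsingleton (extMod R M (ModuleCat.of R R) i)

universe u

namespace ExtVanishing

open Abelian

variable {C : Type*} [Category* C] [Abelian C] [HasExt.{u} C] {S : ShortComplex C}

lemma covariant₁ (hS : S.ShortExact) (X : C) {i j : ℕ} (hij : i + 1 = j)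
    (h₃ : Subsingleton (Ext X S.X₃ i)) (h₂ : Subsingleton (Ext X S.X₂ j)) :
    Subsingleton (Ext X S.X₁ j) := by
  refine subsingleton_of_forall_eq 0 fun e => ?_
  obtain ⟨y, rfl⟩ := Ext.covariant_sequence_exact₁ X hS e (Subsingleton.elim _ _) hij
  rw [Subsingleton.elim y 0, Ext.zero_comp]

lemma covariant₃ (hS : S.ShortExact) (X : C) {i j : ℕ} (hij : i + 1 = j)
    (h₂ : Subsingleton (Ext X S.X₂ i)) (h₁ : Subsingleton (Ext X S.X₁ j)) :
    Subsingleton (Ext X S.X₃ i) := by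
  refine subsingleton_of_forall_eq 0 fun e => ?_
  obtain ⟨y, rfl⟩ := Ext.covariant_sequence_exact₃ X hS e hij (Subsingleton.elim _ _)
  rw [Subsingleton.elim y 0, Ext.zero_comp]

lemma contravariant₁ (hS : S.ShortExact) (Y : C) {i j : ℕ} (hij : i + 1 = j)
    (h₂ : Subsingleton (Ext S.X₂ Y i)) (h₃ : Subsingleton (Ext S.X₃ Y j)) :
    Subsingleton (Ext S.X₁ Y i) := by
  refine subsingleton_of_forall_eq 0 fun e => ?_
  obtain ⟨y, rfl⟩ := Ext.contravariant_sequence_exact₁ hS Y e ((add_comm 1 i).trans hij)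
    (Subsingleton.elim _ _)
  rw [Subsingleton.elim y 0, Ext.comp_zero]

lemma contravariant₂ (hS : S.ShortExact) (Y : C) {i : ℕ}
    (h₁ : Subsingleton (Ext S.X₁ Y i)) (h₃ : Subsingleton (Ext S.X₃ Y i)) :
    Subsingleton (Ext S.X₂ Y i) := by
  refine subsingleton_of_forall_eq 0 fun e => ?_
  obtain ⟨y, rfl⟩ := Ext.contravariant_sequence_exact₂ hS Y e (Subsingleton.elim _ _)
  rw [Subsingleton.elim y 0, Ext.comp_zero]

lemma contravariant₃ (hS : S.ShortExact) (Y : C) {i j : ℕ} (hij : i + 1 = j)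
    (h₁ : Subsingleton (Ext S.X₁ Y i)) (h₂ : Subsingleton (Ext S.X₂ Y j)) :
    Subsingleton (Ext S.X₃ Y j) := by
  refine subsingleton_of_forall_eq 0 fun e => ?_
  obtain ⟨y, rfl⟩ := Ext.contravariant_sequence_exact₃ hS Y e (Subsingleton.elim _ _)
    ((add_comm 1 i).trans hij)
  rw [Subsingleton.elim y 0, Ext.comp_zero]

lemma congr_left {X X' : C} (e : X ≅ X') (Y : C) (i : ℕ) (h : Subsingleton (Ext X Y i)) :
    Subsingleton (Ext X' Y i) := by
  refine subsingleton_of_forall_eq 0 fun x => ?_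
  have : (Ext.mk₀ e.inv).comp ((Ext.mk₀ e.hom).comp x (zero_add i)) (zero_add i) = x := by
    simp
  rw [← this, Subsingleton.elim ((Ext.mk₀ e.hom).comp x (zero_add i)) 0, Ext.comp_zero]

end ExtVanishing

namespace ModuleCat

open Abelian IsLocalRing ExtVanishing

variable {A : Type u} [CommRing A]

/-- The short exact sequence in `ModuleCat A` given by an exact pair of linear maps. -/
lemma shortExact_of_exact {M₁ M₂ M₃ : Type u} [AddCommGroup M₁] [Module A M₁] [AddCommGroup M₂]
    [Module A M₂] [AddCommGroup M₃] [Module A M₃] (f : M₁ →ₗ[A] M₂) (g : M₂ →ₗ[A] M₃)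
    (hf : Function.Injective f) (hg : Function.Surjective g) (h : Function.Exact f g) :
    (ModuleCat.shortComplexOfCompEqZero f g h.linearMap_comp_eq_zero).ShortExact :=
  ModuleCat.shortComplex_shortExact _ h hf hg

lemma exists_shortExact_injective (M : ModuleCat.{u} A) :
    ∃ (S : ShortComplex (ModuleCat.{u} A)), S.ShortExact ∧ S.X₁ = M ∧ Injective S.X₂ := by
  obtain ⟨I, _, f, _⟩ := EnoughInjectives.presentation M
  exact ⟨ShortComplex.mk f (Limits.cokernel.π f) (Limits.cokernel.condition f),
    { exact := ShortComplex.exact_cokernel f }, rfl, ‹_›⟩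

/-- The dimension-shifted form of Baer's criterion. -/
lemma hasInjectiveDimensionLE_of_ext_quotient (N : ModuleCat.{u} A) (n : ℕ)
    (h : ∀ I : Ideal A, Subsingleton (Ext (ModuleCat.of A (A ⧸ I)) N (n + 1))) :
    HasInjectiveDimensionLE N n := by
  induction n generalizing N with
  | zero =>
    rw [HasInjectiveDimensionLE, zero_add, ← injective_iff_hasInjectiveDimensionLT_one,
      ← Module.injective_iff_injective_object, ← Module.Baer.iff_injective]
    intro I g
    have hS := shortExact_of_exact I.subtype I.mkQ (Submodule.injective_subtype I)
      (Submodule.mkQ_surjective I) (LinearMap.exact_subtype_mkQ I)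
    have := h I
    obtain ⟨e, he⟩ := Ext.contravariant_sequence_exact₁ hS N (Ext.mk₀ (ModuleCat.ofHom g))
      (add_zero 1) (Subsingleton.elim (α := Ext (ModuleCat.of A (A ⧸ I)) N 1) _ _)
    obtain ⟨e, rfl⟩ := Ext.homEquiv₀.symm.surjective e
    rw [Ext.homEquiv₀_symm_apply, Ext.mk₀_comp_mk₀] at he
    have he' := Ext.homEquiv₀.symm.injective he
    refine ⟨e.hom, fun x hx => ?_⟩
    exact DFunLike.congr_fun (congrArg ModuleCat.Hom.hom he') (⟨x, hx⟩ : I)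
  | succ n ih =>
    obtain ⟨S, hS, rfl, hI⟩ := exists_shortExact_injective N
    rw [HasInjectiveDimensionLE, ← hS.hasInjectiveDimensionLT_X₃_iff n hI]
    exact ih _ fun I => covariant₃ hS _ rfl (Ext.subsingleton_of_injective _ _ _) (h I)

/-- The short exact sequence `0 → A ⧸ (I : a) → A ⧸ I → A ⧸ (I + (a)) → 0`. -/
lemma exists_shortExact_quotient (I J : Ideal A) (a : A) (hJ : ∀ y, y ∈ J ↔ a * y ∈ I) :
    ∃ (f : ModuleCat.of A (A ⧸ J) ⟶ ModuleCat.of A (A ⧸ I))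
      (g : ModuleCat.of A (A ⧸ I) ⟶ ModuleCat.of A (A ⧸ (I ⊔ Ideal.span {a})))
      (w : f ≫ g = 0), (ShortComplex.mk f g w).ShortExact ∧
        ∀ y : A, f.hom (Ideal.Quotient.mk J y) = Ideal.Quotient.mk I (a * y) := by
  let f : (A ⧸ J) →ₗ[A] A ⧸ I := Submodule.mapQ J I (LinearMap.lsmul A A a) fun y hy => (hJ y).1 hy
  let g : (A ⧸ I) →ₗ[A] A ⧸ (I ⊔ Ideal.span {a}) := Submodule.factor le_sup_left
  have hf (y : A) : f (Ideal.Quotient.mk J y) = Ideal.Quotient.mk I (a * y) := rfl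
  have hg (y : A) : g (Ideal.Quotient.mk I y) = Ideal.Quotient.mk _ y := rfl
  have inj : Function.Injective f := by
    rw [injective_iff_map_eq_zero]
    intro y hy
    obtain ⟨y, rfl⟩ := Ideal.Quotient.mk_surjective y
    rw [hf, Ideal.Quotient.eq_zero_iff_mem] at hy
    rwa [Ideal.Quotient.eq_zero_iff_mem, hJ]
  have surj : Function.Surjective g := fun y => by
    obtain ⟨y, rfl⟩ := Ideal.Quotient.mk_surjective y
    exact ⟨_, hg y⟩
  have ex : Function.Exact f g := fun y => by
    obtain ⟨y, rfl⟩ := Ideal.Quotient.mk_surjective y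
    rw [hg, Ideal.Quotient.eq_zero_iff_mem, Submodule.mem_sup]
    constructor
    · rintro ⟨z, hz, w, hw, rfl⟩
      obtain ⟨w, rfl⟩ := Ideal.mem_span_singleton.1 hw
      exact ⟨Ideal.Quotient.mk J w, by
        rw [hf, map_add, Ideal.Quotient.eq_zero_iff_mem.2 hz, zero_add]⟩
    · rintro ⟨w, hw⟩
      obtain ⟨w, rfl⟩ := Ideal.Quotient.mk_surjective w
      rw [hf, eq_comm, Ideal.Quotient.eq] at hw
      exact ⟨_, hw, _, Ideal.mem_span_singleton.2 (dvd_mul_right a w), by ring⟩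
  exact ⟨ModuleCat.ofHom f, ModuleCat.ofHom g, _, shortExact_of_exact f g inj surj ex, hf⟩

/-- Over a noetherian local ring, the injective dimension of a finite module is detected by the
groups `Ext` out of the residue field. -/
lemma hasInjectiveDimensionLE_of_ext_residueField [IsNoetherianRing A] [IsLocalRing A]
    (N : ModuleCat.{u} A) [Module.Finite A N] (n : ℕ)
    (h : ∀ i, n < i → Subsingleton (Ext (ModuleCat.of A (ResidueField A)) N i)) :
    HasInjectiveDimensionLE N n := by
  suffices ∀ I : Ideal A, ∀ i, n < i → Subsingleton (Ext (ModuleCat.of A (A ⧸ I)) N i) from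
    hasInjectiveDimensionLE_of_ext_quotient N n fun I => this I _ (Nat.lt_succ_self n)
  intro I
  induction I using WellFoundedGT.induction with
  | ind I ih =>
  intro i hi
  by_cases hm : I = maximalIdeal A
  · subst hm
    exact h i hi
  by_cases htop : I = ⊤
  · subst htop
    have : Projective (ModuleCat.of A (A ⧸ (⊤ : Ideal A))) :=
      (ModuleCat.isZero_of_subsingleton _).projective
    obtain ⟨j, rfl⟩ : ∃ j, i = j + 1 := ⟨i - 1, by omega⟩
    exact Ext.subsingleton_of_projective _ _ _
  have lt_sup {a : A} (ha : a ∉ I) : I < I ⊔ Ideal.span {a} :=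
    lt_of_le_of_ne le_sup_left fun h => ha (h ▸ Ideal.mem_sup_right (Ideal.mem_span_singleton_self a))
  by_cases hp : I.IsPrime
  · obtain ⟨x, hx, hxI⟩ := SetLike.exists_of_lt
      (lt_of_le_of_ne (le_maximalIdeal htop) hm)
    obtain ⟨f, g, w, hS, hf⟩ := exists_shortExact_quotient I I x fun y =>
      ⟨fun hy => I.mul_mem_left x hy, fun hy => (hp.mem_or_mem hy).resolve_left hxI⟩
    have hfx : f = x • 𝟙 _ := by
      refine ModuleCat.hom_ext (LinearMap.ext fun y => ?_)
      obtain ⟨y, rfl⟩ := Ideal.Quotient.mk_surjective y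
      exact hf y
    have := ih _ (lt_sup hxI) (i + 1) (by omega)
    have hsub : (⊤ : Submodule A (Ext (ModuleCat.of A (A ⧸ I)) N i)) ≤ maximalIdeal A • ⊤ := by
      intro e _
      obtain ⟨e', he'⟩ : ∃ e' : Ext (ModuleCat.of A (A ⧸ I)) N i,
          (Ext.mk₀ f).comp e' (zero_add i) = e :=
        Ext.contravariant_sequence_exact₁ hS N e (add_comm 1 i)
          (Subsingleton.elim (α := Ext (ModuleCat.of A (A ⧸ _)) N (i + 1)) _ _)
      rw [hfx, Ext.mk₀_smul, Ext.smul_comp, Ext.mk₀_id_comp] at he'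
      exact he' ▸ Submodule.smul_mem_smul hx trivial
    have hbot := Submodule.eq_bot_of_le_smul_of_le_jacobson_bot (maximalIdeal A) ⊤
      (Module.Finite.fg_top) hsub (IsLocalRing.maximalIdeal_le_jacobson ⊥)
    exact (Submodule.subsingleton_iff A).1 (subsingleton_of_bot_eq_top hbot.symm)
  · obtain ⟨a, ha, b, hb, hab⟩ : ∃ a, a ∉ I ∧ ∃ b, b ∉ I ∧ a * b ∈ I := by
      by_contra! hc
      exact hp ⟨htop, fun {x y} hxy => or_iff_not_imp_left.2 fun hx => by_contra fun hy =>
        hc x hx y hy hxy⟩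
    let J : Ideal A := Submodule.comap (LinearMap.lsmul A A a) I
    obtain ⟨f, g, w, hS, -⟩ := exists_shortExact_quotient I J a fun y => Iff.rfl
    have hJ : I < J := lt_of_le_of_ne (fun y hy => I.mul_mem_left a hy) fun h => hb (h ▸ hab)
    exact contravariant₂ hS N (ih J hJ i hi) (ih _ (lt_sup ha) i hi)

end ModuleCat

namespace ModuleCat

open Abelian ExtVanishing

section Coextend

variable {A B : Type u} [CommRing A] [CommRing B] (f : A →+* B)

lemma coextendScalars_injective (I : ModuleCat.{u} A) [Injective I] :
    Injective ((coextendScalars f).obj I) :=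
  (restrictCoextendScalarsAdj f).map_injective I inferInstance

lemma coextendScalars_shortExact {S : ShortComplex (ModuleCat.{u} A)} (hS : S.ShortExact)
    (h : Subsingleton (Ext ((restrictScalars f).obj (ModuleCat.of B B)) S.X₁ 1)) :
    (S.map (coextendScalars f)).ShortExact := by
  have : (coextendScalars.{u, u, u} f).IsRightAdjoint := (restrictCoextendScalarsAdj f).isRightAdjoint
  have := hS.mono_f
  have := hS.epi_g
  have hepi : Epi ((coextendScalars f).map S.g) := by
    rw [ModuleCat.epi_iff_surjective]
    intro (φ : (restrictScalars f).obj (ModuleCat.of B B) →ₗ[A] S.X₃)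
    obtain ⟨e, he⟩ := Ext.covariant_sequence_exact₃ _ hS (Ext.mk₀ (ModuleCat.ofHom φ)) (zero_add 1)
      (Subsingleton.elim _ _)
    obtain ⟨e, rfl⟩ := Ext.homEquiv₀.symm.surjective e
    rw [Ext.homEquiv₀_symm_apply, Ext.mk₀_comp_mk₀] at he
    have he' := Ext.homEquiv₀.symm.injective he
    exact ⟨e.hom, congrArg ModuleCat.Hom.hom he'⟩
  have ex := hS.exact.map_of_mono_of_preservesKernel (coextendScalars f) hS.mono_f inferInstance
  exact { exact := ex, mono_f := inferInstanceAs (Mono ((coextendScalars f).map S.f)), epi_g := hepi }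

lemma ext_succ_subsingleton_of_injective_X₂ {S : ShortComplex (ModuleCat.{u} A)} (hS : S.ShortExact)
    [Injective S.X₂] (X : ModuleCat.{u} A)
    (h : ∀ i, 0 < i → Subsingleton (Ext X S.X₁ i)) (i : ℕ) (hi : 0 < i) :
    Subsingleton (Ext X S.X₃ i) := by
  obtain ⟨j, rfl⟩ : ∃ j, i = j + 1 := ⟨i - 1, by omega⟩
  exact covariant₃ hS X rfl (Ext.subsingleton_of_injective _ _ _) (h _ (by omega))

lemma coextendScalars_hasInjectiveDimensionLE (N : ModuleCat.{u} A) (n : ℕ)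
    (h : ∀ i, 0 < i → Subsingleton (Ext ((restrictScalars f).obj (ModuleCat.of B B)) N i))
    (hN : HasInjectiveDimensionLE N n) :
    HasInjectiveDimensionLE ((coextendScalars f).obj N) n := by
  induction n generalizing N with
  | zero =>
    rw [HasInjectiveDimensionLE, zero_add, ← injective_iff_hasInjectiveDimensionLT_one] at *
    exact coextendScalars_injective f N
  | succ n ih =>
    obtain ⟨S, hS, rfl, hI⟩ := exists_shortExact_injective N
    have hI' : Injective (S.map (coextendScalars f)).X₂ := coextendScalars_injective f S.X₂
    rw [HasInjectiveDimensionLE, ← hS.hasInjectiveDimensionLT_X₃_iff n hI] at hN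
    exact ((coextendScalars_shortExact f hS (h 1 one_pos)).hasInjectiveDimensionLT_X₃_iff n hI').1
      (ih _ (ext_succ_subsingleton_of_injective_X₂ hS _ h) hN)

lemma ext_restrictScalars_subsingleton (N : ModuleCat.{u} A) (n : ℕ)
    (h : ∀ i, 0 < i → Subsingleton (Ext ((restrictScalars f).obj (ModuleCat.of B B)) N i))
    (hN : HasInjectiveDimensionLE ((coextendScalars f).obj N) n) (X : ModuleCat.{u} B)
    (i : ℕ) (hi : n < i) : Subsingleton (Ext ((restrictScalars f).obj X) N i) := by
  obtain ⟨k, rfl⟩ : ∃ k, i = n + k + 1 := ⟨i - n - 1, by omega⟩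
  induction hm : n + k generalizing N n k with
  | zero =>
    obtain ⟨rfl, rfl⟩ : n = 0 ∧ k = 0 := by omega
    rw [HasInjectiveDimensionLE, zero_add, ← injective_iff_hasInjectiveDimensionLT_one] at hN
    obtain ⟨S, hS, rfl, hI⟩ := exists_shortExact_injective N
    have hS' := coextendScalars_shortExact f hS (h 1 one_pos)
    have hN' : Injective (S.map (coextendScalars f)).X₁ := hN
    obtain ⟨s, hs⟩ : ∃ s, s ≫ (coextendScalars f).map S.g = 𝟙 ((coextendScalars f).obj S.X₃) :=
      ⟨hS'.splittingOfInjective.s, hS'.splittingOfInjective.s_g⟩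
    refine subsingleton_of_forall_eq 0 fun e => ?_
    have := Ext.subsingleton_of_injective ((restrictScalars f).obj X) S.X₂ 0
    obtain ⟨y, rfl⟩ := Ext.covariant_sequence_exact₁ _ hS e (Subsingleton.elim _ _) (zero_add 1)
    obtain ⟨y, rfl⟩ := Ext.homEquiv₀.symm.surjective y
    let adj := restrictCoextendScalarsAdj.{u} f
    let z : (restrictScalars f).obj X ⟶ S.X₂ :=
      (adj.homEquiv _ _).symm ((adj.homEquiv _ _) y ≫ s)
    have hz : z ≫ S.g = y := by
      rw [← adj.homEquiv_naturality_right_symm, Category.assoc, hs, Category.comp_id,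
        Equiv.symm_apply_apply]
    rw [← hz, Ext.homEquiv₀_symm_apply, ← Ext.mk₀_comp_mk₀, Ext.comp_assoc_of_second_deg_zero,
      hS.comp_extClass, Ext.comp_zero]
  | succ m ih =>
    obtain ⟨S, hS, rfl, hI⟩ := exists_shortExact_injective N
    have hS' := coextendScalars_shortExact f hS (h 1 one_pos)
    have hI' : Injective (S.map (coextendScalars f)).X₂ := coextendScalars_injective f S.X₂
    have h' := ext_succ_subsingleton_of_injective_X₂ hS _ h
    refine covariant₁ hS _ rfl ?_ (Ext.subsingleton_of_injective _ _ _)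
    match n with
    | 0 =>
      obtain ⟨l, rfl⟩ : ∃ l, k = l + 1 := ⟨k - 1, by omega⟩
      have : HasInjectiveDimensionLT ((coextendScalars f).obj S.X₁) 1 := hN
      have := (hS'.hasInjectiveDimensionLT_X₃_iff 0 hI').2
        (hasInjectiveDimensionLT_of_ge ((coextendScalars f).obj S.X₁) 1 2 (by omega))
      exact (ih S.X₃ 0 h' this l (by omega) (by omega))
    | n + 1 =>
      have := (hS'.hasInjectiveDimensionLT_X₃_iff n hI').2 hN
      convert (ih S.X₃ n h' this k (by omega) (by omega)) using 2

end Coextend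

end ModuleCat

namespace ModuleCat

open Abelian ExtVanishing IsLocalRing

variable {A : Type u} [CommRing A]

section Quotient

variable (J : Ideal A)

/-- Evaluation at `1` on `Hom_A(A ⧸ J, M)`. -/
noncomputable def coextendEval (M : ModuleCat.{u} A)
    (φ : (coextendScalars (Ideal.Quotient.mk J)).obj M) : M :=
  CoextendScalars.equiv _ M φ (1 : A ⧸ J)

variable {J} {M : ModuleCat.{u} A}

lemma coextendEval_add (φ ψ : (coextendScalars (Ideal.Quotient.mk J)).obj M) :
    coextendEval J M (φ + ψ) = coextendEval J M φ + coextendEval J M ψ := rfl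

lemma coextendEval_zero : coextendEval J M 0 = 0 := rfl

lemma apply_mk (φ : (coextendScalars (Ideal.Quotient.mk J)).obj M) (a : A) :
    CoextendScalars.equiv _ M φ (Ideal.Quotient.mk J a) = a • coextendEval J M φ :=
  (congrArg (CoextendScalars.equiv _ M φ) (mul_one (Ideal.Quotient.mk J a)).symm).trans
    (map_smul (CoextendScalars.equiv _ M φ) a (1 : A ⧸ J))

lemma coextendEval_smul (a : A) (φ : (coextendScalars (Ideal.Quotient.mk J)).obj M) :
    coextendEval J M (Ideal.Quotient.mk J a • φ) = a • coextendEval J M φ := by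
  rw [← apply_mk, coextendEval]
  exact (CoextendScalars.smul_apply _ M φ _ _).trans (by rw [one_mul])

lemma coextendEval_injective : Function.Injective (coextendEval J M) := by
  intro φ ψ h
  refine CoextendScalars.ext (LinearMap.ext fun b => ?_)
  obtain ⟨a, rfl⟩ := Ideal.Quotient.mk_surjective (I := J) b
  exact (apply_mk φ a).trans ((congrArg (a • ·) h).trans (apply_mk ψ a).symm)

lemma smul_coextendEval (φ : (coextendScalars (Ideal.Quotient.mk J)).obj M) {a : A} (ha : a ∈ J) :
    a • coextendEval J M φ = 0 := by
  rw [← coextendEval_smul, Ideal.Quotient.eq_zero_iff_mem.2 ha, zero_smul, coextendEval_zero]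

lemma exists_coextendEval_eq (m : M) (hm : ∀ a ∈ J, a • m = 0) :
    ∃ φ, coextendEval J M φ = m := by
  let φ : (A ⧸ J) →ₗ[A] M := Submodule.liftQ J (LinearMap.toSpanSingleton A M m) fun a ha => hm a ha
  refine ⟨(CoextendScalars.equiv (Ideal.Quotient.mk J) M).symm φ, ?_⟩
  exact one_smul A m

/-- The residue field of a local ring is restricted from any nontrivial quotient. -/
lemma exists_restrictScalars_iso_residueField [IsLocalRing A] (hJ : J ≤ maximalIdeal A) :
    ∃ X : ModuleCat.{u} (A ⧸ J), Nonempty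
      ((restrictScalars (Ideal.Quotient.mk J)).obj X ≅ ModuleCat.of A (ResidueField A)) := by
  let := Module.compHom (ResidueField A)
    (Ideal.Quotient.lift J (residue A) fun a ha => (residue_eq_zero_iff a).2 (hJ ha))
  refine ⟨ModuleCat.of (A ⧸ J) (ResidueField A), ⟨LinearEquiv.toModuleIso
    { AddEquiv.refl (ResidueField A) with map_smul' := fun a y => ?_ }⟩⟩
  exact (Algebra.smul_def a (y : ResidueField A)).symm

end Quotient

section Regular

variable {x : A}

lemma ext_quotient_span_singleton (hx : x ∈ nonZeroDivisors A) (N : ModuleCat.{u} A) (i : ℕ)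
    (hi : 1 < i) : Subsingleton (Ext (ModuleCat.of A (A ⧸ Ideal.span {x})) N i) := by
  obtain ⟨j, rfl⟩ : ∃ j, i = j + 2 := ⟨i - 2, by omega⟩
  have hS := shortExact_of_exact (LinearMap.lsmul A A x) (Ideal.span {x}).mkQ
    (fun a b h => (mul_cancel_left_mem_nonZeroDivisors hx).1 h) (Submodule.mkQ_surjective _)
    (fun a => by
      rw [Submodule.mkQ_apply, Submodule.Quotient.mk_eq_zero, Ideal.mem_span_singleton']
      exact ⟨fun ⟨b, hb⟩ => ⟨b, (mul_comm x b).trans hb⟩, fun ⟨b, hb⟩ => ⟨b, (mul_comm b x).trans hb⟩⟩)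
  exact contravariant₃ hS N rfl (Ext.subsingleton_of_projective (ModuleCat.of A A) _ _)
    (Ext.subsingleton_of_projective (ModuleCat.of A A) _ _)

/-- If `0 → A → I → N → 0` is exact with `I` injective and `x` is a nonzerodivisor, then there is
an exact sequence `0 → Hom(A ⧸ x, I) → Hom(A ⧸ x, N) → A ⧸ x → 0`. -/
lemma exists_shortExact_coextendScalars (hx : x ∈ nonZeroDivisors A)
    {I N : ModuleCat.{u} A} (ι : ModuleCat.of A A ⟶ I) (π : I ⟶ N) (w : ι ≫ π = 0)
    (hS : (ShortComplex.mk ι π w).ShortExact) [hI : Injective I] :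
    ∃ T : ShortComplex (ModuleCat.{u} (A ⧸ Ideal.span {x})), T.ShortExact ∧
      T.X₁ = (coextendScalars (Ideal.Quotient.mk (Ideal.span {x}))).obj I ∧
      T.X₂ = (coextendScalars (Ideal.Quotient.mk (Ideal.span {x}))).obj N ∧
      T.X₃ = ModuleCat.of _ (A ⧸ Ideal.span {x}) := by
  set J := Ideal.span {x}
  have hxJ : x ∈ J := Ideal.mem_span_singleton_self x
  have hι : Function.Injective ι := (ModuleCat.mono_iff_injective ι).1 hS.mono_f
  have hπ : Function.Surjective π := (ModuleCat.epi_iff_surjective π).1 hS.epi_g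
  have hex (i : I) : π i = 0 ↔ ∃ a : A, ι a = i :=
    (ShortComplex.ShortExact.moduleCat_exact_iff_function_exact _).1 hS.exact i
  have hπι (a : A) : π (ι a) = 0 := (hex _).2 ⟨a, rfl⟩
  have hsmul (a b : A) : ι (a * b) = a • ι b := map_smul ι.hom a b
  have hJsmul {M : ModuleCat.{u} A} {m : M} (hm : x • m = 0) : ∀ a ∈ J, a • m = 0 := by
    intro a ha
    obtain ⟨b, rfl⟩ := Ideal.mem_span_singleton'.1 ha
    rw [mul_smul, hm, smul_zero]
  obtain ⟨i₀, hi₀⟩ : ∃ i₀ : I, x • i₀ = ι (1 : A) := by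
    have : Mono (ModuleCat.ofHom (LinearMap.lsmul A A x)) :=
      (ModuleCat.mono_iff_injective _).2 fun a b h => (mul_cancel_left_mem_nonZeroDivisors hx).1 h
    obtain ⟨g, hg⟩ := hI.factors ι (ModuleCat.ofHom (LinearMap.lsmul A A x))
    refine ⟨g (1 : A), ?_⟩
    rw [← hg, ← map_smul]
    rfl
  obtain ⟨n₀, hn₀⟩ := exists_coextendEval_eq (J := J) (M := N) (π i₀)
    (hJsmul (by rw [← map_smul, hi₀, hπι]))
  let G := coextendScalars (Ideal.Quotient.mk J)
  let α : (G.obj I × (A ⧸ J)) →ₗ[A ⧸ J] G.obj N :=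
    (G.map π).hom.coprod (LinearMap.toSpanSingleton (A ⧸ J) _ n₀)
  have hα (φ : G.obj I) (a : A) : coextendEval J N (α (φ, Ideal.Quotient.mk J a)) =
      π (coextendEval J I φ + a • i₀) := by
    rw [LinearMap.coprod_apply, coextendEval_add, LinearMap.toSpanSingleton_apply,
      coextendEval_smul, hn₀, map_add, map_smul]
    rfl
  have inj : Function.Injective α := by
    rw [injective_iff_map_eq_zero]
    rintro ⟨φ, b⟩ h
    obtain ⟨a, rfl⟩ := Ideal.Quotient.mk_surjective b
    have h' := hα φ a
    rw [h, coextendEval_zero, eq_comm, hex] at h'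
    obtain ⟨c, hc⟩ := h'
    have h1 : ι (x * c) = ι a := by
      rw [hsmul, hc, smul_add, smul_coextendEval φ hxJ, zero_add, smul_comm, hi₀, ← hsmul, mul_one]
    have h2 : x * c = a := hι h1
    have ha : Ideal.Quotient.mk J a = 0 :=
      Ideal.Quotient.eq_zero_iff_mem.2 (h2 ▸ J.mul_mem_right c hxJ)
    have h3 : coextendEval J I φ = 0 := by
      have : a • i₀ = ι c := by rw [← h2, mul_comm, mul_smul, hi₀, ← hsmul, mul_one]
      rwa [this, right_eq_add] at hc
    exact Prod.ext (coextendEval_injective h3) ha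
  have surj : Function.Surjective α := by
    intro ψ
    obtain ⟨i, hi⟩ := hπ (coextendEval J N ψ)
    obtain ⟨a, ha⟩ := (hex (x • i)).1 (by rw [map_smul, hi, smul_coextendEval ψ hxJ])
    obtain ⟨φ, hφ⟩ := exists_coextendEval_eq (J := J) (M := I) (i - a • i₀) (hJsmul (by
      rw [smul_sub, smul_comm, hi₀, ← hsmul, mul_one, ha, sub_self]))
    refine ⟨(φ, Ideal.Quotient.mk J a), coextendEval_injective ?_⟩
    rw [hα, hφ, sub_add_cancel, hi]
  let e := LinearEquiv.ofBijective α ⟨inj, surj⟩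
  let p : G.obj N →ₗ[A ⧸ J] (A ⧸ J) := LinearMap.snd (A ⧸ J) (G.obj I) (A ⧸ J) ∘ₗ e.symm.toLinearMap
  have hmap (φ : G.obj I) : (G.map π).hom φ = e (φ, 0) := by
    change _ = α (φ, 0)
    rw [LinearMap.coprod_apply, map_zero, add_zero]
  have hexG : Function.Exact (G.map π).hom p := by
    intro ψ
    constructor
    · intro h
      refine ⟨(e.symm ψ).1, ?_⟩
      rw [hmap, ← e.eq_symm_apply]
      exact Prod.ext rfl h.symm
    · rintro ⟨φ, rfl⟩
      simp [hmap, p]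
  have hinj : Function.Injective (G.map π).hom := fun φ φ' h => by
    rw [hmap, hmap] at h
    exact congrArg Prod.fst (e.injective h)
  have hsurj : Function.Surjective p := fun b => ⟨e (0, b), by simp [p]⟩
  have hT := shortExact_of_exact (G.map π).hom p hinj hsurj hexG
  exact ⟨_, hT, rfl, rfl, rfl⟩

lemma exists_hasInjectiveDimensionLE_quotient_iff [IsNoetherianRing A] [IsLocalRing A]
    (hx : x ∈ nonZeroDivisors A) (hxm : x ∈ maximalIdeal A) :
    (∃ n, HasInjectiveDimensionLE (ModuleCat.of (A ⧸ Ideal.span {x}) (A ⧸ Ideal.span {x})) n) ↔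
      ∃ n, HasInjectiveDimensionLE (ModuleCat.of A A) n := by
  obtain ⟨I, hI, ι, hι⟩ := EnoughInjectives.presentation (ModuleCat.of A A)
  let S := ShortComplex.mk ι (Limits.cokernel.π ι) (Limits.cokernel.condition ι)
  have hS : S.ShortExact := { exact := ShortComplex.exact_cokernel ι }
  obtain ⟨T, hT, h₁, h₂, h₃⟩ := exists_shortExact_coextendScalars hx _ _ _ hS
  have hT₁ : Injective T.X₁ := h₁ ▸ coextendScalars_injective _ I
  have hN (i : ℕ) (hi : 0 < i) :
      Subsingleton (Ext ((restrictScalars (Ideal.Quotient.mk (Ideal.span {x}))).obj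
        (ModuleCat.of _ (A ⧸ Ideal.span {x}))) S.X₃ i) :=
    covariant₃ (X := ModuleCat.of A (A ⧸ Ideal.span {x})) hS rfl (by
      obtain ⟨j, rfl⟩ : ∃ j, i = j + 1 := ⟨i - 1, by omega⟩
      exact Ext.subsingleton_of_injective _ _ _) (ext_quotient_span_singleton hx _ _ (by omega))
  constructor
  · rintro ⟨n, hn⟩
    refine ⟨n + 1, hasInjectiveDimensionLE_of_ext_residueField _ _ fun i hi => ?_⟩
    obtain ⟨j, rfl⟩ : ∃ j, i = j + 1 := ⟨i - 1, by omega⟩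
    obtain ⟨X, ⟨e⟩⟩ := exists_restrictScalars_iso_residueField
      ((Ideal.span_singleton_le_iff_mem _).2 hxm)
    refine covariant₁ hS _ rfl (congr_left e _ _ (ext_restrictScalars_subsingleton
      (Ideal.Quotient.mk (Ideal.span {x})) S.X₃ n hN
      ?_ X j (by omega))) (Ext.subsingleton_of_injective _ _ _)
    rw [HasInjectiveDimensionLE] at hn ⊢
    rw [← h₃] at hn
    have := hT.hasInjectiveDimensionLT_X₂ (n + 1)
      (hasInjectiveDimensionLT_of_ge _ 1 (n + 1) (by omega)) hn
    rwa [h₂] at this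
  · rintro ⟨n, hn⟩
    refine ⟨n, ?_⟩
    have h := coextendScalars_hasInjectiveDimensionLE (Ideal.Quotient.mk (Ideal.span {x})) S.X₃ n hN
      (hS.hasInjectiveDimensionLT_X₃ (n + 1) (hasInjectiveDimensionLT_of_ge _ 1 (n + 1) (by omega))
        (hasInjectiveDimensionLT_of_ge (ModuleCat.of A A) (n + 1) (n + 2) (by omega)))
    rw [HasInjectiveDimensionLE] at h ⊢
    rw [← h₃]
    refine hT.hasInjectiveDimensionLT_X₃ (n + 1) (h₂ ▸ h)
      (hasInjectiveDimensionLT_of_ge _ 1 (n + 2) (by omega))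

end Regular

end ModuleCat

namespace ModuleCat

open Abelian ExtVanishing TensorProduct

section ExtOne

variable {A : Type u} [CommRing A] {F₂ F₁ F₀ M : Type u} [AddCommGroup F₂] [Module A F₂]
  [AddCommGroup F₁] [Module A F₁] [AddCommGroup F₀] [Module A F₀] [AddCommGroup M] [Module A M]

/-- `Ext¹(M, A)` computed from the beginning of a projective resolution. -/
lemma ext_one_subsingleton_iff {d₂ : F₂ →ₗ[A] F₁} {d₁ : F₁ →ₗ[A] F₀} {d₀ : F₀ →ₗ[A] M}
    (h₂ : Function.Exact d₂ d₁) (h₁ : Function.Exact d₁ d₀) (h₀ : Function.Surjective d₀)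
    [Module.Projective A F₀] :
    Subsingleton (Ext (ModuleCat.of A M) (ModuleCat.of A A) 1) ↔
      Function.Exact d₁.dualMap d₂.dualMap := by
  have hS := shortExact_of_exact d₁.range.subtype d₀ (Submodule.injective_subtype _) h₀
    (fun x => (h₁ x).trans (by simp))
  constructor
  · intro h f
    constructor
    · intro hf
      have hk : d₁.ker ≤ f.ker := by
        intro x hx
        obtain ⟨y, rfl⟩ := (h₂ x).1 hx
        exact LinearMap.congr_fun hf y
      let g : d₁.range →ₗ[A] A := d₁.ker.liftQ f hk ∘ₗ d₁.quotKerEquivRange.symm.toLinearMap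
      have hg (x : F₁) : g ⟨d₁ x, x, rfl⟩ = f x := by
        have : d₁.quotKerEquivRange.symm ⟨d₁ x, x, rfl⟩ = Submodule.Quotient.mk x :=
          (LinearEquiv.symm_apply_eq _).2 rfl
        simp only [g, LinearMap.comp_apply, LinearEquiv.coe_coe, this]
        rfl
      obtain ⟨e, he⟩ := Ext.contravariant_sequence_exact₁ hS (ModuleCat.of A A)
        (Ext.mk₀ (ModuleCat.ofHom g)) (add_zero 1)
        (Subsingleton.elim (α := Ext (ModuleCat.of A M) (ModuleCat.of A A) 1) _ _)
      obtain ⟨e, rfl⟩ := Ext.homEquiv₀.symm.surjective e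
      rw [Ext.homEquiv₀_symm_apply, Ext.mk₀_comp_mk₀] at he
      have he' := Ext.homEquiv₀.symm.injective he
      refine ⟨e.hom, LinearMap.ext fun x => ?_⟩
      exact (DFunLike.congr_fun (congrArg ModuleCat.Hom.hom he') (⟨d₁ x, x, rfl⟩ : d₁.range)).trans
        (hg x)
    · rintro ⟨g, rfl⟩
      exact LinearMap.ext fun x => by simp [h₂.apply_apply_eq_zero]
  · intro h
    refine subsingleton_of_forall_eq 0 fun e => ?_
    obtain ⟨x, hx⟩ := Ext.contravariant_sequence_exact₃ hS (ModuleCat.of A A) e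
      (@Subsingleton.elim _ (Ext.subsingleton_of_projective (ModuleCat.of A F₀) _ _) _ _)
      (add_zero 1)
    obtain ⟨g, rfl⟩ := Ext.homEquiv₀.symm.surjective x
    obtain ⟨g', hg'⟩ := (h (g.hom ∘ₗ d₁.rangeRestrict)).1 (LinearMap.ext fun x => by
      have : d₁.rangeRestrict (d₂ x) = 0 := Subtype.ext (h₂.apply_apply_eq_zero x)
      change g.hom (d₁.rangeRestrict (d₂ x)) = 0
      rw [this, map_zero])
    have hg : g = ModuleCat.ofHom d₁.range.subtype ≫ ModuleCat.ofHom g' := by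
      refine ModuleCat.hom_ext (LinearMap.ext ?_)
      rintro ⟨_, x, rfl⟩
      exact (LinearMap.congr_fun hg' x).symm
    rw [← hx, Ext.homEquiv₀_symm_apply, hg, ← Ext.mk₀_comp_mk₀]
    exact hS.extClass_comp_assoc _

end ExtOne

section BaseChange

variable {R S : Type u} [CommRing R] [CommRing S] [Algebra R S]

lemma exact_dualMap_baseChange_iff [Module.FaithfullyFlat R S] {F₂ F₁ F₀ : Type u}
    [AddCommGroup F₂] [Module R F₂] [AddCommGroup F₁] [Module R F₁] [AddCommGroup F₀] [Module R F₀]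
    [Module.Free R F₂] [Module.Finite R F₂] [Module.Free R F₁] [Module.Finite R F₁]
    [Module.Free R F₀] [Module.Finite R F₀] (d₂ : F₂ →ₗ[R] F₁) (d₁ : F₁ →ₗ[R] F₀) :
    Function.Exact (d₁.baseChange S).dualMap (d₂.baseChange S).dualMap ↔
      Function.Exact d₁.dualMap d₂.dualMap := by
  have key {V W : Type u} [AddCommGroup V] [Module R V] [AddCommGroup W] [Module R W]
      [Module.Free R V] [Module.Finite R V] [Module.Free R W] [Module.Finite R W]
      (f : V →ₗ[R] W) (x : S ⊗[R] Module.Dual R W) :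
      (f.baseChange S).dualMap ((TensorProduct.isBaseChange R W S).toDualBaseChange x) =
        (TensorProduct.isBaseChange R V S).toDualBaseChange (f.dualMap.lTensor S x) := by
    induction x with
    | zero => simp
    | add x y hx hy => simp only [map_add, hx, hy]
    | tmul s g =>
      refine TensorProduct.AlgebraTensorModule.ext fun t v => ?_
      have h1 := (TensorProduct.isBaseChange R W S).toDualBaseChange_tmul s g (f v)
      have h2 := (TensorProduct.isBaseChange R V S).toDualBaseChange_tmul s (f.dualMap g) v
      have (U : Type u) [AddCommGroup U] [Module R U] (u : U) :
          t ⊗ₜ[R] u = t • ((1 : S) ⊗ₜ[R] u) := by simp [TensorProduct.smul_tmul']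
      rw [LinearMap.dualMap_apply, LinearMap.baseChange_tmul, LinearMap.lTensor_tmul, this,
        this, map_smul, map_smul]
      congr 1
      exact h1.trans h2.symm
  rw [← Module.FaithfullyFlat.lTensor_exact_iff_exact R S]
  refine (Function.Exact.iff_of_ladder_linearEquiv
    (e₁ := ((TensorProduct.isBaseChange R F₀ S).toDualBaseChange).restrictScalars R)
    (e₂ := ((TensorProduct.isBaseChange R F₁ S).toDualBaseChange).restrictScalars R)
    (e₃ := ((TensorProduct.isBaseChange R F₂ S).toDualBaseChange).restrictScalars R)
    (g₁₂ := (d₁.baseChange S).dualMap.restrictScalars R)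
    (g₂₃ := (d₂.baseChange S).dualMap.restrictScalars R) ?_ ?_)
  · exact LinearMap.ext fun x => key d₁ x
  · exact LinearMap.ext fun x => key d₂ x

/-- Flat base change for the vanishing of `Ext` into the ring. -/
lemma ext_baseChange_subsingleton_iff [IsNoetherianRing R] [Module.FaithfullyFlat R S]
    (M : Type u) [AddCommGroup M] [Module R M] [Module.Finite R M] (i : ℕ) (hi : 0 < i) :
    Subsingleton (Ext (ModuleCat.of S (S ⊗[R] M)) (ModuleCat.of S S) i) ↔
      Subsingleton (Ext (ModuleCat.of R M) (ModuleCat.of R R) i) := by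
  obtain ⟨j, rfl⟩ : ∃ j, i = j + 1 := ⟨i - 1, by omega⟩
  clear hi
  induction j generalizing M with
  | zero =>
    obtain ⟨F₀, _, _, _, _, d₀, h₀⟩ := Module.exists_finite_presentation R M
    obtain ⟨F₁, _, _, _, _, p₁, hp₁⟩ := Module.exists_finite_presentation R d₀.ker
    obtain ⟨F₂, _, _, _, _, p₂, hp₂⟩ := Module.exists_finite_presentation R p₁.ker
    have h₁ : Function.Exact (d₀.ker.subtype ∘ₗ p₁) d₀ := fun x =>
      ⟨fun hx => (hp₁ ⟨x, hx⟩).imp fun y hy => congrArg Subtype.val hy, by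
        rintro ⟨y, rfl⟩
        exact (p₁ y).2⟩
    have h₂ : Function.Exact (p₁.ker.subtype ∘ₗ p₂) (d₀.ker.subtype ∘ₗ p₁) := fun x =>
      ⟨fun hx => (hp₂ ⟨x, Subtype.ext hx⟩).imp fun y hy => congrArg Subtype.val hy, by
        rintro ⟨y, rfl⟩
        exact congrArg Subtype.val (p₂ y).2⟩
    rw [zero_add, ext_one_subsingleton_iff h₂ h₁ h₀, ← exact_dualMap_baseChange_iff (S := S)]
    exact ext_one_subsingleton_iff (Module.Flat.lTensor_exact S h₂) (Module.Flat.lTensor_exact S h₁)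
      (d₀ := d₀.baseChange S) (LinearMap.lTensor_surjective S h₀)
  | succ j ih =>
    obtain ⟨F, _, _, _, _, d, h⟩ := Module.exists_finite_presentation R M
    have hR := shortExact_of_exact d.ker.subtype d (Submodule.injective_subtype _) h
      d.exact_subtype_ker_map
    have hS := shortExact_of_exact (d.ker.subtype.baseChange S) (d.baseChange S)
      (Module.Flat.lTensor_preserves_injective_linearMap _ (Submodule.injective_subtype _))
      (LinearMap.lTensor_surjective S h) (Module.Flat.lTensor_exact S d.exact_subtype_ker_map)
    have hF (n : ℕ) : Subsingleton (Ext (ModuleCat.of R F) (ModuleCat.of R R) (n + 1)) :=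
      Ext.subsingleton_of_projective _ _ _
    have hSF (n : ℕ) :
        Subsingleton (Ext (ModuleCat.of S (S ⊗[R] F)) (ModuleCat.of S S) (n + 1)) :=
      Ext.subsingleton_of_projective _ _ _
    exact ⟨fun h => contravariant₃ hR _ rfl
        ((ih _).1 (contravariant₁ hS _ rfl (hSF j) h)) (hF (j + 1)),
      fun h => contravariant₃ hS _ rfl
        ((ih _).2 (contravariant₁ hR _ rfl (hF j) h)) (hSF (j + 1))⟩

end BaseChange

end ModuleCat

namespace ModuleCat

open Abelian ExtVanishing IsLocalRing

section Socle

variable {A : Type u} [CommRing A] [IsNoetherianRing A] [IsLocalRing A]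

lemma exists_annihilator_eq_maximalIdeal
    (h : ∀ x ∈ maximalIdeal A, x ∉ nonZeroDivisors A) :
    ∃ s : A, ∀ a, a * s = 0 ↔ a ∈ maximalIdeal A := by
  obtain ⟨P, hP, hle⟩ : ∃ P ∈ associatedPrimes A A, maximalIdeal A ≤ P :=
    ((maximalIdeal A).subset_union_prime_finite (associatedPrimes.finite ..) (f := id) 0 0
      fun _ h _ _ ↦ h.1).1 <| biUnion_associatedPrimes_eq_compl_nonZeroDivisors A ▸ h
  rw [AssociatedPrimes.mem_iff, isAssociatedPrime_iff] at hP
  obtain ⟨hP, s, hs⟩ := hP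
  refine ⟨s, fun a => ?_⟩
  rw [(maximalIdeal.isMaximal A).eq_of_le hP.ne_top hle, hs, Submodule.mem_colon_singleton]
  rfl

/-- A local ring of depth zero and finite self-injective dimension is self-injective. -/
lemma injective_self_of_annihilator_eq_maximalIdeal {s : A}
    (hs : ∀ a, a * s = 0 ↔ a ∈ maximalIdeal A) {n : ℕ}
    (hn : HasInjectiveDimensionLE (ModuleCat.of A A) n) : Injective (ModuleCat.of A A) := by
  induction n with
  | zero => rwa [injective_iff_hasInjectiveDimensionLT_one]
  | succ n ih =>
    refine ih (hasInjectiveDimensionLE_of_ext_residueField _ n fun i hi => ?_)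
    have hk (a : A) (ha : a ∈ maximalIdeal A) : LinearMap.toSpanSingleton A A s a = 0 :=
      (hs a).2 ha
    let f : (A ⧸ maximalIdeal A) →ₗ[A] A := (maximalIdeal A).liftQ _ hk
    have hf : Function.Injective f := by
      rw [← LinearMap.ker_eq_bot]
      exact Submodule.ker_liftQ_eq_bot _ _ _ fun a ha => (hs a).1 ha
    have hS := shortExact_of_exact f f.range.mkQ hf (Submodule.mkQ_surjective _)
      f.exact_map_mkQ_range
    exact contravariant₁ hS (ModuleCat.of A A) rfl
      (by
        obtain ⟨j, rfl⟩ : ∃ j, i = j + 1 := ⟨i - 1, by omega⟩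
        exact Ext.subsingleton_of_projective (ModuleCat.of A A) _ _)
      (HasInjectiveDimensionLT.subsingleton (ModuleCat.of A A) (n + 2) (i + 1) (by omega) _)

end Socle

section FlatLocal

variable {R S : Type u} [CommRing R] [CommRing S] [Algebra R S]

lemma ext_quotient_map_subsingleton_iff [IsNoetherianRing R] [Module.FaithfullyFlat R S]
    (I : Ideal R) (i : ℕ) (hi : 0 < i) :
    Subsingleton (Ext (ModuleCat.of S (S ⧸ I.map (algebraMap R S))) (ModuleCat.of S S) i) ↔
      Subsingleton (Ext (ModuleCat.of R (R ⧸ I)) (ModuleCat.of R R) i) := by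
  let e := (Algebra.TensorProduct.quotIdealMapEquivTensorQuot S I).toLinearEquiv.toModuleIso
  rw [← ext_baseChange_subsingleton_iff (S := S) (R ⧸ I) i hi]
  exact ⟨congr_left e _ i, congr_left e.symm _ i⟩

lemma mul_algebraMap_eq_zero_iff [Module.Flat R S] {s : R} {I : Ideal R}
    (hs : ∀ a, a * s = 0 ↔ a ∈ I) (t : S) :
    t * algebraMap R S s = 0 ↔ t ∈ I.map (algebraMap R S) := by
  constructor
  · intro ht
    obtain ⟨k, a, y, h₁, h₂⟩ := Module.Flat.iff_forall_isTrivialRelation.1 ‹_›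
      (f := fun _ : Fin 1 => s) (x := fun _ => t) (by simpa [Algebra.smul_def, mul_comm] using ht)
    rw [show t = _ from h₁ 0]
    refine Ideal.sum_mem _ fun j _ => ?_
    rw [Algebra.smul_def]
    refine Ideal.mul_mem_right _ _ (Ideal.mem_map_of_mem _ ((hs _).1 ?_))
    simpa [mul_comm] using h₂ j
  · intro ht
    have : I.map (algebraMap R S) ≤ (LinearMap.toSpanSingleton S S (algebraMap R S s)).ker := by
      rw [Ideal.map_le_iff_le_comap]
      intro a ha
      rw [Ideal.mem_comap, LinearMap.mem_ker, LinearMap.toSpanSingleton_apply, smul_eq_mul,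
        ← map_mul, (hs a).2 ha, map_zero]
    exact this ht

variable [IsNoetherianRing R] [Module.FaithfullyFlat R S]

/-- If `R` is self-injective and `I` is the annihilator of `s`, then `s` generates the annihilator
of `IS`. -/
lemma exists_eq_mul_algebraMap [Injective (ModuleCat.of R R)] {s : R} {I : Ideal R}
    (hs : ∀ a, a * s = 0 ↔ a ∈ I) (t : S)
    (ht : ∀ a ∈ I.map (algebraMap R S), a * t = 0) : ∃ r, t = r * algebraMap R S s := by
  have h := (ext_quotient_map_subsingleton_iff (S := S) (Ideal.span {s}) 1 one_pos).2
    (Ext.subsingleton_of_injective _ _ _)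
  have h₂ : Function.Exact (I.map (algebraMap R S)).subtype
      (LinearMap.toSpanSingleton S S (algebraMap R S s)) := fun t => by
    rw [LinearMap.toSpanSingleton_apply, smul_eq_mul, mul_algebraMap_eq_zero_iff hs]
    simp
  have h₁ : Function.Exact (LinearMap.toSpanSingleton S S (algebraMap R S s))
      ((Ideal.span {s}).map (algebraMap R S)).mkQ := fun t => by
    rw [Submodule.mkQ_apply, Submodule.Quotient.mk_eq_zero, Ideal.map_span, Set.image_singleton,
      Ideal.mem_span_singleton']
    rfl
  obtain ⟨g, hg⟩ := ((ext_one_subsingleton_iff h₂ h₁ (Submodule.mkQ_surjective _)).1 h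
    (LinearMap.toSpanSingleton S S t)).1 (LinearMap.ext fun a => ht a a.2)
  refine ⟨g 1, ?_⟩
  have := LinearMap.congr_fun hg 1
  simp only [LinearMap.dualMap_apply, LinearMap.toSpanSingleton_apply, one_smul] at this
  rw [← this, mul_comm, ← smul_eq_mul, ← map_smul, smul_eq_mul, mul_one]

lemma nonempty_iso_coextendScalars [Injective (ModuleCat.of R R)] {s : R} {I : Ideal R}
    (hs : ∀ a, a * s = 0 ↔ a ∈ I) :
    Nonempty (ModuleCat.of (S ⧸ I.map (algebraMap R S)) (S ⧸ I.map (algebraMap R S)) ≅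
      (coextendScalars (Ideal.Quotient.mk (I.map (algebraMap R S)))).obj (ModuleCat.of S S)) := by
  set J := I.map (algebraMap R S)
  obtain ⟨n₀, hn₀⟩ := exists_coextendEval_eq (J := J) (M := ModuleCat.of S S) (algebraMap R S s)
    fun a ha => (mul_algebraMap_eq_zero_iff hs a).2 ha
  refine ⟨(LinearEquiv.ofBijective (LinearMap.toSpanSingleton (S ⧸ J) _ n₀)
    ⟨?_, fun φ => ?_⟩).toModuleIso⟩
  · rw [injective_iff_map_eq_zero]
    intro b hb
    obtain ⟨a, rfl⟩ := Ideal.Quotient.mk_surjective b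
    rw [LinearMap.toSpanSingleton_apply] at hb
    have := coextendEval_smul a n₀
    rw [hb, hn₀, coextendEval_zero] at this
    exact Ideal.Quotient.eq_zero_iff_mem.2 ((mul_algebraMap_eq_zero_iff hs a).1 this.symm)
  · obtain ⟨r, hr⟩ := exists_eq_mul_algebraMap hs (coextendEval J (ModuleCat.of S S) φ)
      fun a ha => smul_coextendEval φ ha
    refine ⟨Ideal.Quotient.mk J r, coextendEval_injective ?_⟩
    rw [LinearMap.toSpanSingleton_apply, coextendEval_smul, hn₀, hr]
    rfl

variable (R S) in
/-- The case of a base of depth zero. -/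
lemma exists_hasInjectiveDimensionLE_iff_of_annihilator_eq_maximalIdeal
    [IsLocalRing R] [IsNoetherianRing S] [IsLocalRing S] [IsLocalHom (algebraMap R S)] {s : R}
    (hs : ∀ a, a * s = 0 ↔ a ∈ maximalIdeal R) :
    (∃ n, HasInjectiveDimensionLE (ModuleCat.of S S) n) ↔
      (∃ n, HasInjectiveDimensionLE (ModuleCat.of R R) n) ∧
        ∃ n, HasInjectiveDimensionLE (ModuleCat.of (S ⧸ (maximalIdeal R).map (algebraMap R S))
          (S ⧸ (maximalIdeal R).map (algebraMap R S))) n := by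
  set J := (maximalIdeal R).map (algebraMap R S)
  have hJ [Injective (ModuleCat.of R R)] (i : ℕ) (hi : 0 < i) :
      Subsingleton (Ext ((restrictScalars (Ideal.Quotient.mk J)).obj (ModuleCat.of _ (S ⧸ J)))
        (ModuleCat.of S S) i) :=
    (ext_quotient_map_subsingleton_iff (S := S) (maximalIdeal R) i hi).2 (by
      obtain ⟨j, rfl⟩ : ∃ j, i = j + 1 := ⟨i - 1, by omega⟩
      exact Ext.subsingleton_of_injective _ _ _)
  constructor
  · rintro ⟨n, hn⟩
    have hR : HasInjectiveDimensionLE (ModuleCat.of R R) n :=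
      hasInjectiveDimensionLE_of_ext_residueField _ n fun i hi =>
        (ext_quotient_map_subsingleton_iff (S := S) (maximalIdeal R) i (by omega)).1
          (HasInjectiveDimensionLT.subsingleton _ (n + 1) i (by omega) _)
    have := injective_self_of_annihilator_eq_maximalIdeal hs hR
    obtain ⟨e⟩ := nonempty_iso_coextendScalars (S := S) hs
    have := coextendScalars_hasInjectiveDimensionLE _ _ n hJ hn
    exact ⟨⟨n, hR⟩, n, hasInjectiveDimensionLT_of_iso e.symm (n + 1)⟩
  · rintro ⟨⟨m, hm⟩, n, hn⟩
    have := injective_self_of_annihilator_eq_maximalIdeal hs hm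
    obtain ⟨e⟩ := nonempty_iso_coextendScalars (S := S) hs
    refine ⟨n, hasInjectiveDimensionLE_of_ext_residueField _ n fun i hi => ?_⟩
    obtain ⟨X, ⟨e'⟩⟩ := exists_restrictScalars_iso_residueField (J := J)
      (map_maximalIdeal_le (algebraMap R S))
    exact congr_left e' _ _ (ext_restrictScalars_subsingleton (Ideal.Quotient.mk J) _ n hJ
      (hasInjectiveDimensionLT_of_iso e (n + 1)) X i hi)

end FlatLocal

end ModuleCat

namespace ModuleCat

open Abelian ExtVanishing IsLocalRing

lemma exists_hasInjectiveDimensionLE_congr {A B : Type u} [CommRing A] [CommRing B] (e : A ≃+* B) :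
    (∃ n, HasInjectiveDimensionLE (ModuleCat.of A A) n) ↔
      ∃ n, HasInjectiveDimensionLE (ModuleCat.of B B) n := by
  let := RingHomInvPair.of_ringEquiv e
  let := RingHomInvPair.symm (RingHomClass.toRingHom e) (RingHomClass.toRingHom e.symm)
  exact exists_congr fun n => hasInjectiveDimensionLE_iff_of_semiLinearEquiv e
    (M := ModuleCat.of A A) (N := ModuleCat.of B B)
    { e.toAddEquiv with map_smul' := fun a b => map_mul e a b } n

lemma maximalIdeal_quotient {R : Type u} [CommRing R] [IsLocalRing R] (I : Ideal R)
    [IsLocalRing (R ⧸ I)] :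
    maximalIdeal (R ⧸ I) = (maximalIdeal R).map (Ideal.Quotient.mk I) := by
  have : IsLocalHom (Ideal.Quotient.mk I) :=
    IsLocalHom.of_surjective _ Ideal.Quotient.mk_surjective
  have := ((local_hom_TFAE (Ideal.Quotient.mk I)).out 0 4).1 this
  rw [← this, Ideal.map_comap_of_surjective _ Ideal.Quotient.mk_surjective]

lemma exists_ringKrullDim_eq_natCast (R : Type u) [CommRing R] [FiniteRingKrullDim R] :
    ∃ d : ℕ, ringKrullDim R = d := by
  obtain ⟨e, he⟩ := WithBot.ne_bot_iff_exists.1 (ringKrullDim_ne_bot (R := R))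
  have htop : e ≠ ⊤ := fun h => ringKrullDim_ne_top (R := R) (by rw [← he, h]; rfl)
  obtain ⟨d, rfl⟩ := ENat.ne_top_iff_exists.1 htop
  exact ⟨d, he.symm⟩

theorem exists_hasInjectiveDimensionLE_iff_of_flat_local (R S : Type u) [CommRing R] [CommRing S]
    [IsNoetherianRing R] [IsNoetherianRing S] [IsLocalRing R] [IsLocalRing S] [Algebra R S]
    [Module.Flat R S] [IsLocalHom (algebraMap R S)] :
    (∃ n, HasInjectiveDimensionLE (ModuleCat.of S S) n) ↔
      (∃ n, HasInjectiveDimensionLE (ModuleCat.of R R) n) ∧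
        ∃ n, HasInjectiveDimensionLE (ModuleCat.of (S ⧸ (maximalIdeal R).map (algebraMap R S))
          (S ⧸ (maximalIdeal R).map (algebraMap R S))) n := by
  obtain ⟨d, hd⟩ : ∃ d : ℕ, ringKrullDim R < d := by
    obtain ⟨d, hd⟩ := exists_ringKrullDim_eq_natCast R
    exact ⟨d + 1, by rw [hd]; exact_mod_cast d.lt_succ_self⟩
  induction d generalizing R S with
  | zero => exact absurd hd (not_lt.2 ringKrullDim_nonneg_of_nontrivial)
  | succ d ih =>
    have := Module.FaithfullyFlat.of_flat_of_isLocalHom (A := R) (B := S)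
    by_cases h : ∃ x ∈ maximalIdeal R, x ∈ nonZeroDivisors R
    · obtain ⟨x, hxm, hx⟩ := h
      set I := Ideal.span {x}
      have hI : I ≤ maximalIdeal R := (Ideal.span_singleton_le_iff_mem _).2 hxm
      have hIS : I.map (algebraMap R S) = Ideal.span {algebraMap R S x} := by
        rw [Ideal.map_span, Set.image_singleton]
      have hxS : algebraMap R S x ∈ nonZeroDivisors S := by
        have := Module.Flat.isSMulRegular_of_nonZeroDivisors (M := S) hx
        rw [mem_nonZeroDivisors_iff_right]
        intro y hy
        refine this ?_
        simpa [Algebra.smul_def, mul_comm] using hy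
      have hxmS : algebraMap R S x ∈ maximalIdeal S :=
        map_maximalIdeal_le (algebraMap R S) (Ideal.mem_map_of_mem _ hxm)
      have hIS' : I.map (algebraMap R S) ≤ maximalIdeal S :=
        hIS ▸ (Ideal.span_singleton_le_iff_mem _).2 hxmS
      have : Nontrivial (R ⧸ I) :=
        Ideal.Quotient.nontrivial_iff.2 (ne_top_of_le_ne_top (maximalIdeal.isMaximal R).ne_top hI)
      have : Nontrivial (S ⧸ I.map (algebraMap R S)) := Ideal.Quotient.nontrivial_iff.2
        (ne_top_of_le_ne_top (maximalIdeal.isMaximal S).ne_top hIS')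
      have : IsLocalRing (R ⧸ I) := .of_surjective' _ Ideal.Quotient.mk_surjective
      have : IsLocalRing (S ⧸ I.map (algebraMap R S)) :=
        .of_surjective' _ Ideal.Quotient.mk_surjective
      have : Module.Flat (R ⧸ I) (S ⧸ I.map (algebraMap R S)) := Module.Flat.of_linearEquiv
        (Algebra.TensorProduct.quotIdealMapEquivQuotTensor S I).toLinearEquiv
      have hcomp : (algebraMap (R ⧸ I) (S ⧸ I.map (algebraMap R S))).comp (Ideal.Quotient.mk I) =
        (Ideal.Quotient.mk (I.map (algebraMap R S))).comp (algebraMap R S) := rfl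
      have hmap : (maximalIdeal (R ⧸ I)).map (algebraMap (R ⧸ I) (S ⧸ I.map (algebraMap R S))) =
          ((maximalIdeal R).map (algebraMap R S)).map
            (Ideal.Quotient.mk (I.map (algebraMap R S))) := by
        rw [maximalIdeal_quotient, Ideal.map_map, Ideal.map_map, hcomp]
      have : IsLocalHom (algebraMap (R ⧸ I) (S ⧸ I.map (algebraMap R S))) := by
        refine ((local_hom_TFAE _).out 0 2).2 ?_
        rw [hmap, maximalIdeal_quotient]
        exact Ideal.map_mono (map_maximalIdeal_le (algebraMap R S))
      have hdim : ringKrullDim (R ⧸ I) < d := by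
        have h1 := (ringKrullDim_quotient_succ_le_of_nonZeroDivisor hx).trans_lt hd
        obtain ⟨e, he⟩ := exists_ringKrullDim_eq_natCast (R ⧸ I)
        rw [he] at h1 ⊢
        norm_cast at h1 ⊢
        omega
      have key := ih (R ⧸ I) (S ⧸ I.map (algebraMap R S)) hdim
      rw [exists_hasInjectiveDimensionLE_quotient_iff hx hxm,
        exists_hasInjectiveDimensionLE_congr (Ideal.quotEquivOfEq hIS),
        exists_hasInjectiveDimensionLE_quotient_iff hxS hxmS,
        exists_hasInjectiveDimensionLE_congr ((Ideal.quotEquivOfEq hmap).trans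
          (DoubleQuot.quotQuotEquivQuotOfLE (Ideal.map_mono hI)))] at key
      exact key
    · push Not at h
      obtain ⟨s, hs⟩ := exists_annihilator_eq_maximalIdeal h
      exact exists_hasInjectiveDimensionLE_iff_of_annihilator_eq_maximalIdeal R S hs

end ModuleCat

lemma subsingleton_extMod_iff (R : Type) [CommRing R] (M N : ModuleCat R) (i : ℕ) (hi : 0 < i) :
    Subsingleton (extMod R M N i) ↔ Subsingleton (Abelian.Ext M N i) := by
  obtain ⟨j, rfl⟩ : ∃ j, i = j + 1 := ⟨i - 1, by omega⟩
  let P := projectiveResolution M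
  rw [extMod, ((P.isoExt (R := R) (j + 1) N).toLinearEquiv.toEquiv).subsingleton_congr,
    ← ModuleCat.isZero_iff_subsingleton, ← HomologicalComplex.exactAt_iff_isZero_homology,
    HomologicalComplex.exactAt_iff' _ j (j + 1) (j + 2) (by simp) (by simp),
    ShortComplex.moduleCat_exact_iff]
  constructor
  · intro h
    refine subsingleton_of_forall_eq 0 fun a => ?_
    obtain ⟨f, hf, rfl⟩ := P.extMk_surjective a (j + 2) rfl
    rw [P.extMk_eq_zero_iff _ _ _ _ j rfl]
    exact h f hf
  · intro h f hf
    exact (P.extMk_eq_zero_iff f (j + 2) rfl hf j rfl).1 (Subsingleton.elim _ _)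

lemma isGorenstein_iff (R : Type) [CommRing R] :
    IsGorenstein R ↔ ∃ n, HasInjectiveDimensionLE (ModuleCat.of R R) n := by
  constructor
  · rintro ⟨n, hn⟩
    exact ⟨n, ModuleCat.hasInjectiveDimensionLE_of_ext_quotient _ n fun I =>
      (subsingleton_extMod_iff R _ _ _ n.succ_pos).1 (hn _ _ n.lt_succ_self)⟩
  · rintro ⟨n, hn⟩
    exact ⟨n, fun M i hi => (subsingleton_extMod_iff R _ _ _ (by omega)).2
      (HasInjectiveDimensionLT.subsingleton _ (n + 1) i (by omega) _)⟩

/-- Ascent and descent of the Gorenstein property along a flat local homomorphism. -/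
theorem gorenstein_iff_of_flat_local
    (R S : Type) [CommRing R] [CommRing S] [IsNoetherianRing R] [IsNoetherianRing S]
    [IsLocalRing R] [IsLocalRing S] [Algebra R S] [Module.Flat R S]
    [IsLocalHom (algebraMap R S)] :
    IsGorenstein S ↔
      IsGorenstein R ∧
        IsGorenstein (S ⧸ (IsLocalRing.maximalIdeal R).map (algebraMap R S)) := by
  rw [isGorenstein_iff, isGorenstein_iff, isGorenstein_iff]
  exact ModuleCat.exists_hasInjectiveDimensionLE_iff_of_flat_local R S
end

section
/- Let φ: (R, m, k) → (S, n, l) be a flat local ring homomorphism of commutative noetherian local rings, and set F = S/mS with residue field l. Then the Bass series multiply: I_S(t) = I_R(t) · I_F(t); equivalently, for every n ≥ 0 one has μ^n_S = Σ_{i+j=n} μ^i_R · μ^j_F, where μ^i denotes the i-th Bass number of the respective local ring. -/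
/-!
STATEMENT 1: For a flat local homomorphism φ: (R,m,k) → (S,n,l) of commutative
noetherian local rings, with closed fibre F = S/mS, the Bass series multiply:
μ^n_S = Σ_{i+j=n} μ^i_R · μ^j_F for all n.
-/

open CategoryTheory

/-- The length of an `R`-module, encoded as the Krull dimension of its lattice of
submodules (for modules of finite length this is the usual Jordan–Hölder length). -/
noncomputable def moduleLength (R : Type) [CommRing R] (M : Type) [AddCommGroup M]
    [Module R M] : WithBot ℕ∞ :=
  Order.krullDim (Submodule R M)

/-- The `i`-th Bass number of a ring `T` with respect to an ideal `J` (for a local ring one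
takes `J` to be the maximal ideal, so that `T ⧸ J` is the residue field `κ`):
`μ^i = dim_κ Ext^i_T(κ, T)`, which (the Ext module being a `κ`-vector space) coincides with
its length as a `T`-module. -/
noncomputable def bassNumber (T : Type) [CommRing T] (J : Ideal T) (i : ℕ) : WithBot ℕ∞ :=
  moduleLength T (extMod T (ModuleCat.of T (T ⧸ J)) (ModuleCat.of T T) i)

section CompareExt

theorem extMk_zero_eq_zero_iff {C : Type*} [Category* C] [Abelian C] [HasExt C] {X Y : C}
    (P : ProjectiveResolution X) (f : P.complex.X 0 ⟶ Y) (hf : P.complex.d 1 0 ≫ f = 0) :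
    P.extMk f 1 rfl hf = 0 ↔ f = 0 := by
  refine ⟨fun h ↦ ?_, fun h ↦ by subst h; simp⟩
  rw [← P.extEquivCohomologyClass.apply_eq_iff_eq, P.extEquivCohomologyClass_extMk,
    P.extEquivCohomologyClass_zero, CochainComplex.HomComplex.CohomologyClass.mk_eq_zero_iff,
    CochainComplex.HomComplex.Cocycle.toSingleMk_mem_coboundaries_iff _ _ _ _ _ 1 (by simp)] at h
  obtain ⟨g, hg⟩ := h
  have h0 : P.cochainComplex.d (-(0 : ℕ)) 1 = 0 :=
    (P.cochainComplex.isZero_of_isStrictlyLE 0 1).eq_of_tgt _ _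
  rw [h0, Limits.zero_comp] at hg
  rw [← cancel_epi (P.cochainComplexXIso (-(0 : ℕ)) 0 rfl).hom, ← hg, Limits.comp_zero]

theorem smul_extMk {A : Type*} [Ring A] {C : Type*} [Category* C] [Abelian C] [Linear A C]
    [HasExt C] {X Y : C} (P : ProjectiveResolution X) {n m : ℕ} (hm : n + 1 = m) (r : A)
    (f : P.complex.X n ⟶ Y) (hf : P.complex.d m n ≫ f = 0) :
    r • P.extMk f m hm hf = P.extMk (r • f) m hm (by simp [hf]) := by
  rw [Abelian.Ext.smul_eq_comp_mk₀, P.extMk_comp_mk₀]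
  simp

/-- The `Ext` functor defined by deriving `Hom` agrees with `Abelian.Ext` up to isomorphism. -/
theorem nonempty_extMod_linearEquiv (R : Type) [CommRing R] (M N : ModuleCat R) (i : ℕ) :
    Nonempty (extMod R M N i ≃ₗ[R] Abelian.Ext M N i) := by
  let P := projectiveResolution M
  let K := P.complex.linearYonedaObj R N
  obtain ⟨p, hp, hpi⟩ : ∃ p, (ComplexShape.up ℕ).prev i = p ∧
      ∀ (f : P.complex.X i ⟶ N) (hf : P.complex.d (i + 1) i ≫ f = 0),
        P.extMk f (i + 1) rfl hf = 0 ↔ ∃ g : P.complex.X p ⟶ N, P.complex.d i p ≫ g = f := by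
    cases i with
    | zero =>
      refine ⟨0, by simp, fun f hf ↦ (extMk_zero_eq_zero_iff P f hf).trans ?_⟩
      simp [eq_comm]
    | succ n => exact ⟨n, by simp, fun f hf ↦ P.extMk_eq_zero_iff f _ rfl hf n rfl⟩
  let T := K.sc' p i (i + 1)
  have hker (f : LinearMap.ker T.g.hom) :
      P.complex.d (i + 1) i ≫ (show P.complex.X i ⟶ N from f.1) = 0 := f.2
  let φ : LinearMap.ker T.g.hom →ₗ[R] Abelian.Ext M N i :=
    { toFun f := P.extMk (show P.complex.X i ⟶ N from f.1) (i + 1) rfl (hker f)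
      map_add' f g := (P.add_extMk (f.1 : P.complex.X i ⟶ N) g.1 (i + 1) rfl (hker f) (hker g)).symm
      map_smul' r f := (smul_extMk P rfl r (f.1 : P.complex.X i ⟶ N) (hker f)).symm }
  have hφ : Function.Surjective φ := fun x ↦ by
    obtain ⟨f, hf, rfl⟩ := P.extMk_surjective x (i + 1) rfl
    exact ⟨⟨f, hf⟩, rfl⟩
  have hφk : LinearMap.ker φ = LinearMap.range T.moduleCatToCycles := by
    ext f
    refine (hpi f.1 (hker f)).trans ⟨?_, ?_⟩
    · rintro ⟨g, hg⟩
      exact ⟨g, Subtype.ext hg⟩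
    · rintro ⟨g, hg⟩
      exact ⟨g, congrArg Subtype.val hg⟩
  exact ⟨(P.isoExt i N ≪≫ K.homologyIsoSc' p i (i + 1) hp (by simp) ≪≫
    T.moduleCatHomologyIso).toLinearEquiv ≪≫ₗ
    Submodule.quotEquivOfEq _ _ hφk.symm ≪≫ₗ φ.quotKerEquivOfSurjective hφ⟩

end CompareExt

section DimensionShifting

open Abelian

variable {A : Type*} [CommRing A] {C : Type*} [Category* C] [Abelian C] [Linear A C] [HasExt C]
  {T : ShortComplex C}

/-- If the middle term of a short exact sequence is projective, then `Ext^(n+1)(X₃, Y)` is the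
cokernel of `Ext^n(X₂, Y) ⟶ Ext^n(X₁, Y)`. -/
theorem nonempty_ext_succ_linearEquiv_of_projective (hT : T.ShortExact)
    [Projective T.X₂] (Y : C) (n : ℕ) :
    Nonempty ((Ext T.X₁ Y n ⧸ LinearMap.range
      ((Ext.mk₀ T.f).precompOfLinear A Y (zero_add n))) ≃ₗ[A] Ext T.X₃ Y (n + 1)) := by
  let δ := hT.extClass.precompOfLinear A Y (add_comm 1 n)
  have hδ : Function.Surjective δ := fun x ↦
    Ext.contravariant_sequence_exact₃ hT Y x (Ext.eq_zero_of_projective _) (add_comm 1 n)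
  have hk : LinearMap.ker δ = LinearMap.range
      ((Ext.mk₀ T.f).precompOfLinear A Y (zero_add n)) := by
    ext x
    refine ⟨fun hx ↦ Ext.contravariant_sequence_exact₁ hT Y x (add_comm 1 n) hx, ?_⟩
    rintro ⟨y, rfl⟩
    exact hT.extClass_comp_assoc y (h := add_comm 1 n)
  exact ⟨Submodule.quotEquivOfEq _ _ hk.symm ≪≫ₗ δ.quotKerEquivOfSurjective hδ⟩

/-- If the middle term of a short exact sequence is injective, then `Ext^(n+1)(X, X₁)` is the
cokernel of `Ext^n(X, X₂) ⟶ Ext^n(X, X₃)`. -/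
theorem nonempty_ext_succ_linearEquiv_of_injective (hT : T.ShortExact)
    [Injective T.X₂] (X : C) (n : ℕ) :
    Nonempty ((Ext X T.X₃ n ⧸ LinearMap.range
      ((Ext.mk₀ T.g).postcompOfLinear A X (add_zero n))) ≃ₗ[A] Ext X T.X₁ (n + 1)) := by
  let δ := hT.extClass.postcompOfLinear A X (rfl : n + 1 = n + 1)
  have hδ : Function.Surjective δ := fun x ↦
    Ext.covariant_sequence_exact₁ X hT x (Ext.eq_zero_of_injective _) rfl
  have hk : LinearMap.ker δ = LinearMap.range
      ((Ext.mk₀ T.g).postcompOfLinear A X (add_zero n)) := by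
    ext x
    refine ⟨fun hx ↦ Ext.covariant_sequence_exact₃ X hT x rfl hx, ?_⟩
    rintro ⟨y, rfl⟩
    change (y.comp (Ext.mk₀ T.g) (add_zero n)).comp hT.extClass rfl = 0
    simp
  exact ⟨Submodule.quotEquivOfEq _ _ hk.symm ≪≫ₗ δ.quotKerEquivOfSurjective hδ⟩

theorem nonempty_ext_shift_linearEquiv_of_projective (hT : T.ShortExact)
    [Projective T.X₂] (Y : C) (n : ℕ) :
    Nonempty (Ext T.X₁ Y (n + 1) ≃ₗ[A] Ext T.X₃ Y (n + 2)) := by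
  obtain ⟨e⟩ := nonempty_ext_succ_linearEquiv_of_projective (A := A) hT Y (n + 1)
  refine ⟨(Submodule.quotEquivOfEqBot _ ?_).symm ≪≫ₗ e⟩
  rw [LinearMap.range_eq_bot]
  ext x
  rw [Ext.eq_zero_of_projective x, map_zero, map_zero]

theorem nonempty_ext_shift_linearEquiv_of_injective (hT : T.ShortExact)
    [Injective T.X₂] (X : C) (n : ℕ) :
    Nonempty (Ext X T.X₃ (n + 1) ≃ₗ[A] Ext X T.X₁ (n + 2)) := by
  obtain ⟨e⟩ := nonempty_ext_succ_linearEquiv_of_injective (A := A) hT X (n + 1)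
  refine ⟨(Submodule.quotEquivOfEqBot _ ?_).symm ≪≫ₗ e⟩
  rw [LinearMap.range_eq_bot]
  ext x
  rw [Ext.eq_zero_of_injective x, map_zero, map_zero]

end DimensionShifting

section SplitAndLength

open Abelian

variable {A : Type*} [CommRing A] {C : Type*} [Category* C] [Abelian C] [Linear A C] [HasExt C]
  {T : ShortComplex C}

variable (A) in
/-- Postcomposition with a split short exact sequence. -/
theorem postcompOfLinear_exact_of_splitting (s : T.Splitting) (X : C) (n : ℕ) :
    Function.Injective ((Ext.mk₀ T.f).postcompOfLinear A X (add_zero n)) ∧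
    Function.Exact ((Ext.mk₀ T.f).postcompOfLinear A X (add_zero n))
      ((Ext.mk₀ T.g).postcompOfLinear A X (add_zero n)) ∧
    Function.Surjective ((Ext.mk₀ T.g).postcompOfLinear A X (add_zero n)) := by
  refine ⟨Function.LeftInverse.injective
    (g := (Ext.mk₀ s.r).postcompOfLinear A X (add_zero n)) fun x ↦ ?_, fun x ↦ ⟨fun hx ↦
    Ext.covariant_sequence_exact₂ X s.shortExact x hx, ?_⟩, Function.RightInverse.surjective
    (g := (Ext.mk₀ s.s).postcompOfLinear A X (add_zero n)) fun x ↦ ?_⟩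
  · change (x.comp (Ext.mk₀ T.f) (add_zero n)).comp (Ext.mk₀ s.r) (add_zero n) = x
    simp
  · rintro ⟨y, rfl⟩
    change (y.comp (Ext.mk₀ T.f) (add_zero n)).comp (Ext.mk₀ T.g) (add_zero n) = 0
    simp
  · change (x.comp (Ext.mk₀ s.s) (add_zero n)).comp (Ext.mk₀ T.g) (add_zero n) = x
    simp

variable (A) in
theorem length_ext_of_splitting (s : T.Splitting) (X : C) (n : ℕ) :
    Module.length A (Ext X T.X₂ n) =
      Module.length A (Ext X T.X₁ n) + Module.length A (Ext X T.X₃ n) := by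
  obtain ⟨h₁, h₂, h₃⟩ := postcompOfLinear_exact_of_splitting A s X n
  exact Module.length_eq_add_of_exact _ _ h₁ h₃ h₂

theorem length_quotient_range_comp {X Y W V : Type*} [AddCommGroup X] [Module A X]
    [AddCommGroup Y] [Module A Y] [AddCommGroup W] [Module A W] [AddCommGroup V] [Module A V]
    (f : X →ₗ[A] Y) (i : Y →ₗ[A] W) (p : W →ₗ[A] V) (hi : Function.Injective i)
    (h : Function.Exact i p) (hp : Function.Surjective p) :
    Module.length A (W ⧸ LinearMap.range (i ∘ₗ f)) =
      Module.length A (Y ⧸ LinearMap.range f) + Module.length A V := by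
  have hle : LinearMap.range (i ∘ₗ f) ≤ LinearMap.ker p := by
    rintro _ ⟨x, rfl⟩
    exact h.apply_apply_eq_zero (f x)
  have hle' : LinearMap.range f ≤ (LinearMap.range (i ∘ₗ f)).comap i := by
    rintro _ ⟨x, rfl⟩
    exact ⟨x, rfl⟩
  refine Module.length_eq_add_of_exact (Submodule.mapQ _ _ i hle')
    (Submodule.liftQ _ p hle) ?_ ?_ ?_
  · rw [← LinearMap.ker_eq_bot, LinearMap.ker_eq_bot']
    intro y hy
    obtain ⟨y, rfl⟩ := Submodule.Quotient.mk_surjective _ y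
    rw [Submodule.mapQ_apply, Submodule.Quotient.mk_eq_zero] at hy
    obtain ⟨x, hx⟩ := hy
    exact (Submodule.Quotient.mk_eq_zero _).2 ⟨x, hi hx⟩
  · intro v
    obtain ⟨w, rfl⟩ := hp v
    exact ⟨Submodule.Quotient.mk w, rfl⟩
  · intro w
    obtain ⟨w, rfl⟩ := Submodule.Quotient.mk_surjective _ w
    refine (h w).trans ⟨?_, ?_⟩
    · rintro ⟨y, rfl⟩
      exact ⟨Submodule.Quotient.mk y, rfl⟩
    · rintro ⟨y, hy⟩
      obtain ⟨y, rfl⟩ := Submodule.Quotient.mk_surjective _ y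
      rw [Submodule.mapQ_apply, Submodule.Quotient.eq] at hy
      obtain ⟨x, hx⟩ := hy
      refine ⟨y - f x, ?_⟩
      rw [map_sub]
      change i y - (i ∘ₗ f) x = w
      rw [hx]
      abel

/-- For an exact sequence `0 ⟶ K ⟶ J ⟶ D ⟶ H ⟶ 0` with `J` injective and `H` projective, the
cokernel of `Ext^n(X, J) ⟶ Ext^n(X, D)` is an extension of `Ext^n(X, H)` by `Ext^(n+1)(X, K)`. -/
theorem length_coker_ext_of_injective_of_projective {K J D H : C} (a : K ⟶ J) (b : J ⟶ D)
    (c : D ⟶ H) [Injective J] [Projective H] [Mono a] [Epi c] (hab : a ≫ b = 0) (hbc : b ≫ c = 0)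
    (h₁ : (ShortComplex.mk a b hab).Exact) (h₂ : (ShortComplex.mk b c hbc).Exact)
    (X : C) (n : ℕ) :
    Module.length A (Ext X D n ⧸ LinearMap.range
      ((Ext.mk₀ b).postcompOfLinear A X (add_zero n))) =
      Module.length A (Ext X K (n + 1)) + Module.length A (Ext X H n) := by
  let b' : J ⟶ Limits.kernel c := Limits.kernel.lift c b hbc
  have hb' : b' ≫ Limits.kernel.ι c = b := Limits.kernel.lift_ι c b hbc
  have hepi : Epi b' := h₂.epi_kernelLift
  have hab' : a ≫ b' = 0 := by
    rw [← cancel_mono (Limits.kernel.ι c), Category.assoc, hb', hab, Limits.zero_comp]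
  let T₁ := ShortComplex.mk a b' hab'
  have hT₁ : T₁.ShortExact :=
    { exact := by
        let φ : T₁ ⟶ ShortComplex.mk a b hab :=
          { τ₁ := 𝟙 _, τ₂ := 𝟙 _, τ₃ := Limits.kernel.ι c }
        exact (ShortComplex.exact_iff_of_epi_of_isIso_of_mono φ).2 h₁
      mono_f := ‹_›
      epi_g := hepi }
  let T₂ := ShortComplex.mk (Limits.kernel.ι c) c (Limits.kernel.condition c)
  have hT₂ : T₂.ShortExact :=
    { exact := ShortComplex.exact_kernel c
      mono_f := inferInstanceAs (Mono (Limits.kernel.ι c))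
      epi_g := ‹_› }
  have : Injective T₁.X₂ := ‹Injective J›
  have : Projective T₂.X₃ := ‹Projective H›
  obtain ⟨e⟩ := nonempty_ext_succ_linearEquiv_of_injective (A := A) hT₁ X n
  obtain ⟨i₁, i₂, i₃⟩ := postcompOfLinear_exact_of_splitting A hT₂.splittingOfProjective X n
  have hcomp : (Ext.mk₀ b).postcompOfLinear A X (add_zero n) =
      (Ext.mk₀ T₂.f).postcompOfLinear A X (add_zero n) ∘ₗ
        (Ext.mk₀ T₁.g).postcompOfLinear A X (add_zero n) := by
    ext x
    change x.comp (Ext.mk₀ b) (add_zero n) = (x.comp (Ext.mk₀ b') (add_zero n)).comp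
      (Ext.mk₀ (Limits.kernel.ι c)) (add_zero n)
    simp [hb']
  rw [← e.length_eq, hcomp]
  exact length_quotient_range_comp _ _ _ i₁ i₂ i₃

end SplitAndLength

section FlatBaseChange

open Abelian TensorProduct

/-- `Ext^0` of modules is the module of linear maps. -/
noncomputable def extZeroLinearEquiv {R : Type} [CommRing R] (M N : ModuleCat R) :
    Ext M N 0 ≃ₗ[R] (M →ₗ[R] N) :=
  Ext.linearEquiv₀ ≪≫ₗ ModuleCat.homLinearEquiv

@[simp]
theorem extZeroLinearEquiv_mk₀ {R : Type} [CommRing R] {M N : ModuleCat R} (f : M ⟶ N) :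
    extZeroLinearEquiv M N (Ext.mk₀ f) = f.hom :=
  congrArg ModuleCat.Hom.hom (Ext.homEquiv₀.right_inv f)

section

variable {R : Type} [CommRing R] {K P M : Type} [AddCommGroup K] [AddCommGroup P] [AddCommGroup M]
  [Module R K] [Module R P] [Module R M] {f : K →ₗ[R] P} {g : P →ₗ[R] M}

theorem shortExact_ofHom (hf : Function.Injective f) (hfg : Function.Exact f g)
    (hg : Function.Surjective g) : (ShortComplex.mk (ModuleCat.ofHom f) (ModuleCat.ofHom g)
      (by ext x; exact hfg.apply_apply_eq_zero x)).ShortExact where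
  exact := (ShortComplex.ShortExact.moduleCat_exact_iff_function_exact _).2 hfg
  mono_f := (ModuleCat.mono_iff_injective _).2 hf
  epi_g := (ModuleCat.epi_iff_surjective _).2 hg

theorem nonempty_ext_one_linearEquiv_of_projective [Module.Projective R P]
    (hf : Function.Injective f) (hfg : Function.Exact f g) (hg : Function.Surjective g)
    (N : ModuleCat R) :
    Nonempty (Ext (ModuleCat.of R M) N 1 ≃ₗ[R]
      ((K →ₗ[R] N) ⧸ LinearMap.range (LinearMap.lcomp R N f))) := by
  have hT := shortExact_ofHom hf hfg hg
  have : Projective (ModuleCat.of R P) := ModuleCat.projective_of_categoryTheory_projective _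
  obtain ⟨e⟩ := nonempty_ext_succ_linearEquiv_of_projective (A := R) hT N 0
  refine ⟨e.symm ≪≫ₗ Submodule.Quotient.equiv _ _ (extZeroLinearEquiv _ N) ?_⟩
  have hcomm (y : Ext (ModuleCat.of R P) N 0) : extZeroLinearEquiv (ModuleCat.of R K) N
      ((Ext.mk₀ (ModuleCat.ofHom f)).comp y (zero_add 0)) =
      LinearMap.lcomp R N f (extZeroLinearEquiv (ModuleCat.of R P) N y) := by
    obtain ⟨ψ, rfl⟩ := Ext.homEquiv₀.symm.surjective y
    change extZeroLinearEquiv _ N ((Ext.mk₀ (ModuleCat.ofHom f)).comp (Ext.mk₀ ψ) _) =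
      LinearMap.lcomp R N f (extZeroLinearEquiv _ N (Ext.mk₀ ψ))
    rw [Ext.mk₀_comp_mk₀, extZeroLinearEquiv_mk₀, extZeroLinearEquiv_mk₀]
    rfl
  ext φ
  constructor
  · rintro ⟨_, ⟨y, rfl⟩, rfl⟩
    exact ⟨_, (hcomm y).symm⟩
  · rintro ⟨ψ, rfl⟩
    obtain ⟨y, rfl⟩ := (extZeroLinearEquiv (ModuleCat.of R P) N).surjective ψ
    exact ⟨_, ⟨y, rfl⟩, hcomm y⟩

theorem nonempty_ext_succ_succ_linearEquiv_of_projective [Module.Projective R P]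
    (hf : Function.Injective f) (hfg : Function.Exact f g) (hg : Function.Surjective g)
    (N : ModuleCat R) (n : ℕ) :
    Nonempty (Ext (ModuleCat.of R M) N (n + 2) ≃ₗ[R] Ext (ModuleCat.of R K) N (n + 1)) := by
  have : Projective (ModuleCat.of R P) := ModuleCat.projective_of_categoryTheory_projective _
  obtain ⟨e⟩ := nonempty_ext_shift_linearEquiv_of_projective (A := R)
    (shortExact_ofHom hf hfg hg) N n
  exact ⟨e.symm⟩

end

variable {R S : Type} [CommRing R] [CommRing S] [Algebra R S]

theorem nonempty_baseChange_quotient_range {B D : Type*} [AddCommGroup B] [AddCommGroup D]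
    [Module R B] [Module R D] (g : B →ₗ[R] D) :
    Nonempty (S ⊗[R] (D ⧸ LinearMap.range g) ≃ₗ[S]
      ((S ⊗[R] D) ⧸ LinearMap.range (g.baseChange S))) := by
  let q := (LinearMap.range g).mkQ
  have hq : Function.Surjective (q.baseChange S) :=
    LinearMap.lTensor_surjective S (Submodule.mkQ_surjective _)
  have hex : Function.Exact (g.baseChange S) (q.baseChange S) :=
    lTensor_exact S (LinearMap.exact_map_mkQ_range g) (Submodule.mkQ_surjective _)
  exact ⟨((Submodule.quotEquivOfEq _ _ (LinearMap.exact_iff.1 hex).symm) ≪≫ₗ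
    (q.baseChange S).quotKerEquivOfSurjective hq).symm⟩

/-- Flat base change for `Ext`. -/
theorem nonempty_ext_baseChange [IsNoetherianRing R] [Module.Flat R S]
    (M N : Type) [AddCommGroup M] [AddCommGroup N] [Module R M] [Module R N] [Module.Finite R M]
    (i : ℕ) :
    Nonempty (Ext (ModuleCat.of S (S ⊗[R] M)) (ModuleCat.of S (S ⊗[R] N)) i ≃ₗ[S]
      S ⊗[R] Ext (ModuleCat.of R M) (ModuleCat.of R N) i) := by
  let E (M : Type) [AddCommGroup M] [Module R M] [Module.FinitePresentation R M] :
      S ⊗[R] (M →ₗ[R] N) ≃ₗ[S] (S ⊗[R] M →ₗ[S] S ⊗[R] N) :=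
    (Module.FinitePresentation.isBaseChange_map R M N S).equiv
  induction i generalizing M with
  | zero =>
    have := Module.finitePresentation_of_finite R M
    exact ⟨extZeroLinearEquiv _ _ ≪≫ₗ (E M).symm ≪≫ₗ
      ((extZeroLinearEquiv (ModuleCat.of R M) (ModuleCat.of R N)).symm.baseChange R S)⟩
  | succ i ih =>
    obtain ⟨m, g, hg⟩ := Module.Finite.exists_fin' R M
    let f := (LinearMap.ker g).subtype
    have hf : Function.Injective f := Submodule.subtype_injective _
    have hfg : Function.Exact f g := LinearMap.exact_subtype_ker_map g
    have hf' : Function.Injective (f.baseChange S) :=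
      Module.Flat.lTensor_preserves_injective_linearMap f hf
    have hfg' : Function.Exact (f.baseChange S) (g.baseChange S) := lTensor_exact S hfg hg
    have hg' : Function.Surjective (g.baseChange S) := LinearMap.lTensor_surjective S hg
    cases i with
    | zero =>
      obtain ⟨e⟩ := nonempty_ext_one_linearEquiv_of_projective hf hfg hg (ModuleCat.of R N)
      obtain ⟨e'⟩ := nonempty_ext_one_linearEquiv_of_projective hf' hfg' hg'
        (ModuleCat.of S (S ⊗[R] N))
      obtain ⟨c⟩ := nonempty_baseChange_quotient_range (S := S) (LinearMap.lcomp R N f)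
      have := Module.finitePresentation_of_finite R (LinearMap.ker g)
      refine ⟨e' ≪≫ₗ (c ≪≫ₗ Submodule.Quotient.equiv _ _ (E _) ?_).symm ≪≫ₗ
        e.symm.baseChange R S⟩
      have hcomm (y : S ⊗[R] ((Fin m → R) →ₗ[R] N)) :
          E (LinearMap.ker g) ((LinearMap.lcomp R N f).baseChange S y) =
            LinearMap.lcomp S (S ⊗[R] N) (f.baseChange S) (E (Fin m → R) y) := by
        induction y with
        | zero => simp
        | add x y hx hy => rw [map_add, map_add, hx, hy, map_add, map_add]
        | tmul s y =>
          simp only [E, LinearMap.baseChange_tmul, IsBaseChange.equiv_tmul, map_smul]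
          congr 1
          ext x
          simp
      ext φ
      constructor
      · rintro ⟨_, ⟨y, rfl⟩, rfl⟩
        exact ⟨_, (hcomm y).symm⟩
      · rintro ⟨ψ, rfl⟩
        obtain ⟨y, rfl⟩ := (E (Fin m → R)).surjective ψ
        exact ⟨_, ⟨y, rfl⟩, hcomm y⟩
    | succ i =>
      obtain ⟨e⟩ := nonempty_ext_succ_succ_linearEquiv_of_projective hf hfg hg (ModuleCat.of R N) i
      obtain ⟨e'⟩ := nonempty_ext_succ_succ_linearEquiv_of_projective hf' hfg' hg'
        (ModuleCat.of S (S ⊗[R] N)) i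
      obtain ⟨c⟩ := ih (LinearMap.ker g)
      exact ⟨e' ≪≫ₗ c ≪≫ₗ e.symm.baseChange R S⟩

end FlatBaseChange

section ResidueField

open Abelian TensorProduct

section

variable {A : Type*} [CommRing A] {C : Type*} [Category* C] [Abelian C] [Linear A C] [HasExt C]

variable (A) in
theorem nonempty_ext_linearEquiv_of_iso {X X' Y Y' : C} (e : X ≅ X') (f : Y ≅ Y') (n : ℕ) :
    Nonempty (Ext X Y n ≃ₗ[A] Ext X' Y' n) := by
  refine ⟨LinearEquiv.ofLinearMap
    ((Ext.mk₀ f.hom).postcompOfLinear A X' (add_zero n) ∘ₗ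
      (Ext.mk₀ e.inv).precompOfLinear A Y (zero_add n))
    ((Ext.mk₀ e.hom).precompOfLinear A Y (zero_add n) ∘ₗ
      (Ext.mk₀ f.inv).postcompOfLinear A X' (add_zero n)) ?_ ?_⟩
  · ext x
    change ((Ext.mk₀ e.inv).comp ((Ext.mk₀ e.hom).comp
      (x.comp (Ext.mk₀ f.inv) (add_zero n)) (zero_add n)) (zero_add n)).comp
      (Ext.mk₀ f.hom) (add_zero n) = x
    simp
  · ext x
    change (Ext.mk₀ e.hom).comp ((((Ext.mk₀ e.inv).comp x (zero_add n)).comp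
      (Ext.mk₀ f.hom) (add_zero n)).comp (Ext.mk₀ f.inv) (add_zero n)) (zero_add n) = x
    simp

theorem smul_ext_eq_zero {X Y : C} {r : A} (h : r • 𝟙 X = 0) {n : ℕ} (x : Ext X Y n) :
    r • x = 0 := by
  have := Ext.smul_comp (Ext.mk₀ (𝟙 X)) x (zero_add n) r
  rw [← Ext.mk₀_smul, h] at this
  simpa using this.symm

end

variable {R : Type} [CommRing R]

theorem exists_linearEquiv_fin_fun (I : Ideal R) [I.IsMaximal] (V : Type*) [AddCommGroup V]
    [Module R V] [Module.Finite R V] (h : Module.IsTorsionBySet R V I) :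
    ∃ d : ℕ, Nonempty (V ≃ₗ[R] (Fin d → R ⧸ I)) := by
  let _ : Field (R ⧸ I) := Ideal.Quotient.field I
  let _ : Module (R ⧸ I) V := h.module
  have : IsScalarTower R (R ⧸ I) V := h.isScalarTower
  have : Module.Finite (R ⧸ I) V := Module.Finite.of_restrictScalars_finite R _ _
  exact ⟨_, ⟨(Module.finBasis (R ⧸ I) V).equivFun.restrictScalars R⟩⟩

theorem length_fin_fun_quotient (I : Ideal R) [I.IsMaximal] (d : ℕ) :
    Module.length R (Fin d → R ⧸ I) = d := by
  have : IsSimpleModule R (R ⧸ I) := isSimpleModule_iff_isCoatom.2 (Ideal.isMaximal_def.1 ‹_›)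
  rw [Module.length_pi, Module.length_eq_one]
  simp

theorem exists_ext_quotient_linearEquiv [IsNoetherianRing R] (I : Ideal R) [I.IsMaximal]
    (N : ModuleCat R) [Module.Finite R N] (i : ℕ) :
    ∃ d : ℕ, Nonempty (Ext (ModuleCat.of R (R ⧸ I)) N i ≃ₗ[R] (Fin d → R ⧸ I)) := by
  refine exists_linearEquiv_fin_fun I _ fun x r ↦ smul_ext_eq_zero ?_ x
  refine ModuleCat.hom_ext (LinearMap.ext fun y ↦ ?_)
  obtain ⟨y, rfl⟩ := Ideal.Quotient.mk_surjective y
  exact Ideal.Quotient.eq_zero_iff_mem.2 (I.mul_mem_right y r.2)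

theorem exists_ext_quotient_map_linearEquiv (S : Type) [CommRing S] [Algebra R S]
    [IsNoetherianRing R] [Module.Flat R S] (I : Ideal R) [I.IsMaximal] (i : ℕ) :
    ∃ d : ℕ, Module.length R (Ext (ModuleCat.of R (R ⧸ I)) (ModuleCat.of R R) i) = d ∧
      Nonempty (Ext (ModuleCat.of S (S ⧸ I.map (algebraMap R S))) (ModuleCat.of S S) i ≃ₗ[S]
        (Fin d → S ⧸ I.map (algebraMap R S))) := by
  obtain ⟨d, ⟨e⟩⟩ := exists_ext_quotient_linearEquiv I (ModuleCat.of R R) i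
  refine ⟨d, e.length_eq.trans (length_fin_fun_quotient I d), ?_⟩
  have : Module.Finite R (R ⧸ I) := inferInstance
  obtain ⟨b⟩ := nonempty_ext_baseChange (S := S) (R := R) (R ⧸ I) R i
  let q : (S ⧸ I.map (algebraMap R S)) ≃ₗ[S] S ⊗[R] (R ⧸ I) :=
    (Algebra.TensorProduct.quotIdealMapEquivTensorQuot S I).toLinearEquiv
  obtain ⟨c⟩ := nonempty_ext_linearEquiv_of_iso S q.toModuleIso
    (AlgebraTensorModule.rid R S S).symm.toModuleIso i
  exact ⟨c ≪≫ₗ b ≪≫ₗ e.baseChange R S ≪≫ₗ piRight R S S _ ≪≫ₗ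
    LinearEquiv.piCongrRight fun _ ↦ q.symm⟩

end ResidueField

section SemilinearLength

variable {A B : Type*} [CommRing A] [CommRing B] {σ : A →+* B} [RingHomSurjective σ]
  {M N : Type*} [AddCommGroup M] [AddCommGroup N] [Module A M] [Module B N]

theorem length_eq_of_bijective_semilinear (f : M →ₛₗ[σ] N) (hf : Function.Bijective f) :
    Module.length A M = Module.length B N := by
  rw [← WithBot.coe_inj, Module.coe_length, Module.coe_length]
  exact Order.krullDim_eq_of_orderIso (Submodule.orderIsoMapComapOfBijective f hf)

theorem length_quotient_eq_of_surjective_semilinear (f : M →ₛₗ[σ] N) (hf : Function.Surjective f)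
    (K : Submodule A M) (hK : K = LinearMap.ker f) :
    Module.length A (M ⧸ K) = Module.length B N := by
  subst hK
  refine length_eq_of_bijective_semilinear (Submodule.liftQ _ f le_rfl) ⟨?_, fun y ↦ ?_⟩
  · rw [← LinearMap.ker_eq_bot, Submodule.ker_liftQ_eq_bot _ _ _ le_rfl]
  · obtain ⟨x, rfl⟩ := hf y
    exact ⟨Submodule.Quotient.mk x, rfl⟩

end SemilinearLength

section Coextension

open Abelian

variable {S F : Type} [CommRing S] [CommRing F] (σ : S →+* F)

/-- The adjunction between restriction and coextension of scalars, as a semilinear map. -/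
noncomputable def homCoextend (L : ModuleCat F) (N : ModuleCat S) :
    ((ModuleCat.restrictScalars σ).obj L ⟶ N) →ₛₗ[σ]
      (L ⟶ (ModuleCat.coextendScalars σ).obj N) where
  toFun f := (ModuleCat.restrictCoextendScalarsAdj σ).homEquiv L N f
  map_add' _ _ := rfl
  map_smul' s f := by
    refine ModuleCat.hom_ext (LinearMap.ext fun y ↦ ModuleCat.CoextendScalars.ext
      (LinearMap.ext fun (t : F) ↦ ?_))
    change s • f.hom (t • y : L) = f.hom ((t * σ s) • y : L)
    rw [mul_comm, mul_smul]
    exact (f.hom.map_smul s (t • y : L)).symm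

/-- The adjunction between restriction and coextension of scalars, as a semilinear map on
`Ext^0`. -/
noncomputable def extZeroCoextend (L : ModuleCat F) (N : ModuleCat S) :
    Ext ((ModuleCat.restrictScalars σ).obj L) N 0 →ₛₗ[σ]
      Ext L ((ModuleCat.coextendScalars σ).obj N) 0 :=
  (Ext.linearEquiv₀ (R := F)).symm.toLinearMap.comp
    ((homCoextend σ L N).comp (Ext.linearEquiv₀ (R := S)).toLinearMap)

theorem extZeroCoextend_mk₀ {L : ModuleCat F} {N : ModuleCat S}
    (f : (ModuleCat.restrictScalars σ).obj L ⟶ N) :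
    extZeroCoextend σ L N (Ext.mk₀ f) =
      Ext.mk₀ ((ModuleCat.restrictCoextendScalarsAdj σ).homEquiv L N f) :=
  congrArg (fun f ↦ Ext.mk₀ (homCoextend σ L N f)) (Ext.homEquiv₀.right_inv f)

theorem extZeroCoextend_bijective (L : ModuleCat F) (N : ModuleCat S) :
    Function.Bijective (extZeroCoextend σ L N) :=
  Ext.homEquiv₀.symm.bijective.comp
    (((ModuleCat.restrictCoextendScalarsAdj σ).homEquiv L N).bijective.comp Ext.homEquiv₀.bijective)

theorem extZeroCoextend_comp (L : ModuleCat F) {N N' : ModuleCat S} (g : N ⟶ N')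
    (x : Ext ((ModuleCat.restrictScalars σ).obj L) N 0) :
    extZeroCoextend σ L N' (x.comp (Ext.mk₀ g) (add_zero 0)) =
      (extZeroCoextend σ L N x).comp (Ext.mk₀ ((ModuleCat.coextendScalars σ).map g))
        (add_zero 0) := by
  obtain ⟨f, rfl⟩ := Ext.homEquiv₀.symm.surjective x
  change extZeroCoextend σ L N' ((Ext.mk₀ f).comp (Ext.mk₀ g) (add_zero 0)) =
    (extZeroCoextend σ L N (Ext.mk₀ f)).comp _ _
  rw [Ext.mk₀_comp_mk₀, extZeroCoextend_mk₀, extZeroCoextend_mk₀, Ext.mk₀_comp_mk₀,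
    Adjunction.homEquiv_naturality_right]

/-- A linear map between restrictions of scalars along a surjection is linear. -/
noncomputable def linearMapOfRestrictScalars {σ : S →+* F} (hσ : Function.Surjective σ)
    {X Y : ModuleCat F}
    (f : (ModuleCat.restrictScalars σ).obj X →ₗ[S] (ModuleCat.restrictScalars σ).obj Y) :
    X →ₗ[F] Y where
  toFun x := f x
  map_add' x y := f.map_add x y
  map_smul' t x := by
    obtain ⟨s, rfl⟩ := hσ t
    exact f.map_smul s x

/-- The underlying module of a coextension of scalars is an `Ext^0`. -/
noncomputable def extZeroLinearEquivCoextend (N : ModuleCat S) :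
    Ext ((ModuleCat.restrictScalars σ).obj (ModuleCat.of F F)) N 0 ≃ₗ[S]
      (ModuleCat.restrictScalars σ).obj ((ModuleCat.coextendScalars σ).obj N) :=
  extZeroLinearEquiv _ N ≪≫ₗ
    { toFun f := (ModuleCat.CoextendScalars.equiv σ N).symm f
      invFun f := ModuleCat.CoextendScalars.equiv σ N f
      map_add' _ _ := rfl
      map_smul' s f := by
        refine ModuleCat.CoextendScalars.ext (LinearMap.ext fun (t : F) ↦ ?_)
        change s • f t = f (t * σ s)
        rw [mul_comm]
        exact (f.map_smul s t).symm
      left_inv _ := rfl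
      right_inv _ := rfl }

end Coextension

section ChangeOfRings

open Abelian

variable {S F : Type} [CommRing S] [CommRing F] {σ : S →+* F}

theorem extZeroLinearEquivCoextend_comp {N N' : ModuleCat S} (g : N ⟶ N')
    (x : Ext ((ModuleCat.restrictScalars σ).obj (ModuleCat.of F F)) N 0) :
    extZeroLinearEquivCoextend σ N' (x.comp (Ext.mk₀ g) (add_zero 0)) =
      ((ModuleCat.coextendScalars σ).map g).hom (extZeroLinearEquivCoextend σ N x) := by
  obtain ⟨f, rfl⟩ := Ext.homEquiv₀.symm.surjective x
  change extZeroLinearEquivCoextend σ N' ((Ext.mk₀ f).comp (Ext.mk₀ g) (add_zero 0)) =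
    ((ModuleCat.coextendScalars σ).map g).hom (extZeroLinearEquivCoextend σ N (Ext.mk₀ f))
  rw [Ext.mk₀_comp_mk₀]
  simp only [extZeroLinearEquivCoextend, LinearEquiv.trans_apply, extZeroLinearEquiv_mk₀]
  rfl

/-- Coextension of scalars along a surjection `S ⟶ F` turns `0 ⟶ X₁ ⟶ X₂ ⟶ X₃ ⟶ 0` with `X₂`
injective into an exact sequence ending in `Ext^1(F, X₁)`. -/
theorem exists_coextend_exact (hσ : Function.Surjective σ) {T : ShortComplex (ModuleCat S)}
    (hT : T.ShortExact) [Injective T.X₂] {H : ModuleCat F}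
    (e : Ext ((ModuleCat.restrictScalars σ).obj (ModuleCat.of F F)) T.X₁ 1 ≃ₗ[S]
      (ModuleCat.restrictScalars σ).obj H) :
    ∃ (c : (ModuleCat.coextendScalars σ).obj T.X₃ ⟶ H)
      (h : (ModuleCat.coextendScalars σ).map T.g ≫ c = 0),
      Epi c ∧ (ShortComplex.mk _ c h).Exact := by
  let δ := hT.extClass.postcompOfLinear S
    ((ModuleCat.restrictScalars σ).obj (ModuleCat.of F F)) (zero_add 1)
  have hδ : Function.Surjective δ := fun x ↦
    Ext.covariant_sequence_exact₁ _ hT x (Ext.eq_zero_of_injective _) rfl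
  let c := linearMapOfRestrictScalars hσ
    (e.toLinearMap ∘ₗ δ ∘ₗ (extZeroLinearEquivCoextend σ T.X₃).symm.toLinearMap)
  have hc : Function.Surjective c :=
    e.surjective.comp (hδ.comp (extZeroLinearEquivCoextend σ T.X₃).symm.surjective)
  have hex : Function.Exact ((ModuleCat.coextendScalars σ).map T.g).hom c := by
    intro y
    obtain ⟨x, rfl⟩ := (extZeroLinearEquivCoextend σ T.X₃).surjective y
    have hcx : c (extZeroLinearEquivCoextend σ T.X₃ x) = e (x.comp hT.extClass (zero_add 1)) :=
      congrArg (fun x ↦ e (δ x)) ((extZeroLinearEquivCoextend σ T.X₃).symm_apply_apply x)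
    rw [hcx]
    constructor
    · intro h
      obtain ⟨z, rfl⟩ := Ext.covariant_sequence_exact₃ _ hT x rfl (e.map_eq_zero_iff.1 h)
      exact ⟨_, (extZeroLinearEquivCoextend_comp T.g z).symm⟩
    · rintro ⟨z, hz⟩
      obtain ⟨z, rfl⟩ := (extZeroLinearEquivCoextend σ T.X₂).surjective z
      have hz' := (extZeroLinearEquivCoextend_comp T.g z).trans hz
      rw [← (extZeroLinearEquivCoextend σ T.X₃).injective hz']
      exact e.map_eq_zero_iff.2 (by simp)
  refine ⟨ModuleCat.ofHom c, ?_, (ModuleCat.epi_iff_surjective _).2 hc,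
    (ShortComplex.ShortExact.moduleCat_exact_iff_function_exact _).2 hex⟩
  exact ModuleCat.hom_ext (LinearMap.ext fun y ↦ hex.apply_apply_eq_zero y)

/-- The length of the cokernel of `Hom(L, X₂) ⟶ Hom(L, X₃)` before and after coextension. -/
theorem length_ext_one_restrictScalars (hσ : Function.Surjective σ)
    {T : ShortComplex (ModuleCat S)} (hT : T.ShortExact) [Injective T.X₂] (L : ModuleCat F) :
    Module.length S (Ext ((ModuleCat.restrictScalars σ).obj L) T.X₁ 1) =
      Module.length F (Ext L ((ModuleCat.coextendScalars σ).obj T.X₃) 0 ⧸ LinearMap.range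
        ((Ext.mk₀ ((ModuleCat.coextendScalars σ).map T.g)).postcompOfLinear F L (add_zero 0))) := by
  have : RingHomSurjective σ := ⟨hσ⟩
  obtain ⟨e⟩ := nonempty_ext_succ_linearEquiv_of_injective (A := S) hT
    ((ModuleCat.restrictScalars σ).obj L) 0
  rw [← e.length_eq]
  refine length_quotient_eq_of_surjective_semilinear
    ((Submodule.mkQ _).comp (extZeroCoextend σ L T.X₃))
    ((Submodule.mkQ_surjective _).comp (extZeroCoextend_bijective σ L T.X₃).2) _ ?_
  ext x
  rw [LinearMap.mem_ker, LinearMap.comp_apply, Submodule.mkQ_apply, Submodule.Quotient.mk_eq_zero]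
  constructor
  · rintro ⟨y, rfl⟩
    exact ⟨_, (extZeroCoextend_comp σ L T.g y).symm⟩
  · rintro ⟨y, hy⟩
    obtain ⟨y, rfl⟩ := (extZeroCoextend_bijective σ L T.X₂).2 y
    exact ⟨y, (extZeroCoextend_bijective σ L T.X₃).1
      ((extZeroCoextend_comp σ L T.g y).trans hy)⟩

/-- If `Ext_S^i(F, N)` is a projective `F`-module for all `i > 0`, then the change of rings
spectral sequence `Ext_F^p(L, Ext_S^q(F, N)) ⇒ Ext_S^(p+q)(L, N)` degenerates on lengths. -/
theorem length_ext_restrictScalars (hσ : Function.Surjective σ) (L : ModuleCat F) (n : ℕ)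
    (N : ModuleCat S) (H : ℕ → ModuleCat F) [∀ i, Projective (H i)]
    (e : ∀ i, Nonempty (Ext ((ModuleCat.restrictScalars σ).obj (ModuleCat.of F F)) N (i + 1) ≃ₗ[S]
      (ModuleCat.restrictScalars σ).obj (H i))) :
    Module.length S (Ext ((ModuleCat.restrictScalars σ).obj L) N n) =
      Module.length F (Ext L ((ModuleCat.coextendScalars σ).obj N) n) +
        ∑ i ∈ Finset.range n, Module.length F (Ext L (H i) (n - (i + 1))) := by
  induction n generalizing N H with
  | zero =>
    have : RingHomSurjective σ := ⟨hσ⟩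
    simpa using length_eq_of_bijective_semilinear _ (extZeroCoextend_bijective σ L N)
  | succ n ih =>
    let T := ShortComplex.mk (Injective.ι N) (Limits.cokernel.π _) (Limits.cokernel.condition _)
    have hT : T.ShortExact :=
      { exact := ShortComplex.exact_cokernel (Injective.ι N)
        mono_f := inferInstanceAs (Mono (Injective.ι N))
        epi_g := inferInstanceAs (Epi (Limits.cokernel.π _)) }
    have : Injective T.X₂ := inferInstanceAs (Injective (Injective.under N))
    have : Injective ((ModuleCat.coextendScalars σ).obj T.X₂) :=
      Injective.injective_of_adjoint (ModuleCat.restrictCoextendScalarsAdj σ) _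
    obtain ⟨e₀⟩ := e 0
    obtain ⟨c, hc, hepi, hex⟩ := exists_coextend_exact hσ hT e₀
    have := hT.mono_f
    have hlen := length_coker_ext_of_injective_of_projective (A := F)
      ((ModuleCat.coextendScalars σ).map T.f) ((ModuleCat.coextendScalars σ).map T.g) c
      (by rw [← Functor.map_comp, T.zero, Functor.map_zero]) hc
      (hT.exact.map_of_mono_of_preservesKernel _ inferInstance inferInstance) hex L n
    rw [Finset.sum_range_succ', add_comm (Finset.sum _ _), ← add_assoc, zero_add,
      Nat.add_sub_cancel]
    refine Eq.trans ?_ (congrArg (· + _) hlen)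
    cases n with
    | zero => simpa using length_ext_one_restrictScalars hσ hT L
    | succ n =>
      obtain ⟨s⟩ := nonempty_ext_shift_linearEquiv_of_injective (A := S) hT
        ((ModuleCat.restrictScalars σ).obj L) n
      refine s.length_eq.symm.trans ((ih T.X₃ (fun i ↦ H (i + 1)) fun i ↦ ?_).trans ?_)
      · obtain ⟨s⟩ := nonempty_ext_shift_linearEquiv_of_injective (A := S) hT
          ((ModuleCat.restrictScalars σ).obj (ModuleCat.of F F)) i
        obtain ⟨e⟩ := e (i + 1)
        exact ⟨s ≪≫ₗ e⟩
      · congr 1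
        · refine (Submodule.quotEquivOfEqBot _ ?_).length_eq.symm
          rw [LinearMap.range_eq_bot]
          ext x
          rw [Ext.eq_zero_of_injective x, map_zero, map_zero]
        · exact Finset.sum_congr rfl fun i _ ↦ by rw [Nat.add_sub_add_right (n + 1) 1 (i + 1)]

end ChangeOfRings

section BassSeries

open Abelian

theorem length_ext_fin_fun {F : Type} [CommRing F] (L : ModuleCat F) (d j : ℕ) :
    Module.length F (Ext L (ModuleCat.of F (Fin d → F)) j) =
      d * Module.length F (Ext L (ModuleCat.of F F) j) := by
  induction d with
  | zero =>
    have : Limits.IsZero (ModuleCat.of F (Fin 0 → F)) := ModuleCat.isZero_of_subsingleton _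
    have : Subsingleton (Ext L (ModuleCat.of F (Fin 0 → F)) j) := ⟨fun x y ↦ by
      rw [← x.comp_mk₀_id, ← y.comp_mk₀_id, this.eq_of_src (𝟙 _) 0]; simp⟩
    simp
  | succ d ih =>
    let e : ModuleCat.of F (Fin (d + 1) → F) ≅ ModuleCat.of F (F × (Fin d → F)) :=
      (Fin.consLinearEquiv F fun _ ↦ F).symm.toModuleIso
    obtain ⟨e'⟩ := nonempty_ext_linearEquiv_of_iso F (Iso.refl L) e j
    let T : ShortComplex (ModuleCat F) := ShortComplex.mk
      (ModuleCat.ofHom (LinearMap.inl F F (Fin d → F)))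
      (ModuleCat.ofHom (LinearMap.snd F F (Fin d → F))) (by ext; rfl)
    let s : T.Splitting :=
      { r := ModuleCat.ofHom (LinearMap.fst F F (Fin d → F))
        s := ModuleCat.ofHom (LinearMap.inr F F (Fin d → F))
        f_r := by ext; rfl
        s_g := by ext; rfl
        id := by
          refine ModuleCat.hom_ext (LinearMap.ext fun x ↦ ?_)
          change (x.1, (0 : Fin d → F)) + ((0 : F), x.2) = x
          simp }
    rw [e'.length_eq, length_ext_of_splitting F s L j, ih, Nat.cast_succ, add_mul, one_mul,
      add_comm]

theorem bassNumber_eq (T : Type) [CommRing T] (J : Ideal T) (i : ℕ) :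
    bassNumber T J i =
      (Module.length T (Ext (ModuleCat.of T (T ⧸ J)) (ModuleCat.of T T) i) : WithBot ℕ∞) := by
  obtain ⟨e⟩ := nonempty_extMod_linearEquiv T (ModuleCat.of T (T ⧸ J)) (ModuleCat.of T T) i
  rw [← e.length_eq, Module.coe_length]
  rfl

/-- The quotient of `F` by the image of an ideal `J` of `S` is `S ⧸ J`, if `J` contains the kernel
of the surjection `S ⟶ F`. -/
theorem nonempty_restrictScalars_quotient_iso {S F : Type} [CommRing S] [CommRing F] {σ : S →+* F}
    (hσ : Function.Surjective σ) (J : Ideal S) (hJ : RingHom.ker σ ≤ J) :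
    Nonempty ((ModuleCat.restrictScalars σ).obj (ModuleCat.of F (F ⧸ J.map σ)) ≅
      ModuleCat.of S (S ⧸ J)) := by
  let q : S →ₗ[S] (ModuleCat.restrictScalars σ).obj (ModuleCat.of F (F ⧸ J.map σ)) :=
    { toFun s := Ideal.Quotient.mk (J.map σ) (σ s)
      map_add' x y := by rw [map_add, map_add]; rfl
      map_smul' r x := by rw [smul_eq_mul, map_mul, map_mul]; rfl }
  have hq : Function.Surjective q := Ideal.Quotient.mk_surjective.comp hσ
  have hk : LinearMap.ker q = J := by
    ext s
    change Ideal.Quotient.mk (J.map σ) (σ s) = 0 ↔ s ∈ J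
    rw [Ideal.Quotient.eq_zero_iff_mem, ← Ideal.mem_comap, Ideal.comap_map_of_surjective' σ hσ,
      sup_eq_left.2 hJ]
  exact ⟨(Submodule.quotEquivOfEq _ _ hk.symm ≪≫ₗ
    q.quotKerEquivOfSurjective hq).toModuleIso.symm⟩

/-- The free module `F^d` over `F = S ⧸ I`, as an `S`-module. -/
noncomputable def restrictScalarsFinFunLinearEquiv {S : Type} [CommRing S] (I : Ideal S) (d : ℕ) :
    (ModuleCat.restrictScalars (Ideal.Quotient.mk I)).obj (ModuleCat.of (S ⧸ I) (Fin d → S ⧸ I))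
      ≃ₗ[S] (Fin d → S ⧸ I) where
  toFun x := x
  invFun x := x
  map_add' _ _ := rfl
  map_smul' _ _ := rfl
  left_inv _ := rfl
  right_inv _ := rfl

/-- The ring `F = S ⧸ I`, as an `S`-module. -/
noncomputable def restrictScalarsQuotientIso {S : Type} [CommRing S] (I : Ideal S) :
    (ModuleCat.restrictScalars (Ideal.Quotient.mk I)).obj (ModuleCat.of (S ⧸ I) (S ⧸ I)) ≅
      ModuleCat.of S (S ⧸ I) :=
  LinearEquiv.toModuleIso
    { toFun x := x
      invFun x := x
      map_add' _ _ := rfl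
      map_smul' _ _ := rfl
      left_inv _ := rfl
      right_inv _ := rfl }

/-- If `Ext_S^i(S ⧸ I, S)` is free of rank `d i` over `S ⧸ I`, then the Bass numbers of `S` are
obtained from those of `S ⧸ I` by convolution with `d`. -/
theorem length_ext_quotient_eq_sum {S : Type} [CommRing S] {I J : Ideal S} (hIJ : I ≤ J)
    (d : ℕ → ℕ) (e : ∀ i, Nonempty (Ext (ModuleCat.of S (S ⧸ I)) (ModuleCat.of S S) i ≃ₗ[S]
      (Fin (d i) → S ⧸ I))) (n : ℕ) :
    Module.length S (Ext (ModuleCat.of S (S ⧸ J)) (ModuleCat.of S S) n) =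
      ∑ i ∈ Finset.range (n + 1), d i * Module.length (S ⧸ I)
        (Ext (ModuleCat.of (S ⧸ I) ((S ⧸ I) ⧸ J.map (Ideal.Quotient.mk I)))
          (ModuleCat.of (S ⧸ I) (S ⧸ I)) (n - i)) := by
  let σ := Ideal.Quotient.mk I
  have hσ : Function.Surjective σ := Ideal.Quotient.mk_surjective
  have e' (i : ℕ) : Nonempty (Ext ((ModuleCat.restrictScalars σ).obj (ModuleCat.of (S ⧸ I) (S ⧸ I)))
      (ModuleCat.of S S) i ≃ₗ[S]
      (ModuleCat.restrictScalars σ).obj (ModuleCat.of (S ⧸ I) (Fin (d i) → S ⧸ I))) := by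
    obtain ⟨c⟩ := nonempty_ext_linearEquiv_of_iso S (restrictScalarsQuotientIso I)
      (Iso.refl (ModuleCat.of S S)) i
    obtain ⟨e⟩ := e i
    exact ⟨c ≪≫ₗ e ≪≫ₗ (restrictScalarsFinFunLinearEquiv I (d i)).symm⟩
  obtain ⟨e₀⟩ := e' 0
  let f := (extZeroLinearEquivCoextend σ (ModuleCat.of S S)).symm ≪≫ₗ e₀
  let g : (ModuleCat.coextendScalars σ).obj (ModuleCat.of S S) ≅
      ModuleCat.of (S ⧸ I) (Fin (d 0) → S ⧸ I) :=
    (LinearEquiv.ofBijective (linearMapOfRestrictScalars hσ f.toLinearMap) f.bijective).toModuleIso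
  obtain ⟨q⟩ := nonempty_restrictScalars_quotient_iso hσ J (Ideal.mk_ker.trans_le hIJ)
  obtain ⟨c⟩ := nonempty_ext_linearEquiv_of_iso S q (Iso.refl (ModuleCat.of S S)) n
  obtain ⟨c₀⟩ := nonempty_ext_linearEquiv_of_iso (S ⧸ I)
    (Iso.refl (ModuleCat.of (S ⧸ I) ((S ⧸ I) ⧸ J.map σ))) g n
  rw [← c.length_eq, length_ext_restrictScalars hσ _ n _
    (fun i ↦ ModuleCat.of (S ⧸ I) (Fin (d (i + 1)) → S ⧸ I)) fun i ↦ e' (i + 1),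
    Finset.sum_range_succ', add_comm (Finset.sum _ _), c₀.length_eq, length_ext_fin_fun]
  simp only [length_ext_fin_fun]
  rfl

end BassSeries

/-- Bass series multiply along a flat local homomorphism:
`I_S(t) = I_R(t) · I_{S/mS}(t)` coefficientwise. Here the residue field of the closed fibre
`F = S ⧸ mS` is `F ⧸ (n·F)` where `n·F` is the image of the maximal ideal `n` of `S`. -/
theorem bass_series_of_flat_local
    (R S : Type) [CommRing R] [CommRing S] [IsNoetherianRing R] [IsNoetherianRing S]
    [IsLocalRing R] [IsLocalRing S] [Algebra R S] [Module.Flat R S]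
    [IsLocalHom (algebraMap R S)] (n : ℕ) :
    bassNumber S (IsLocalRing.maximalIdeal S) n =
      ∑ i ∈ Finset.range (n + 1),
        bassNumber R (IsLocalRing.maximalIdeal R) i *
          bassNumber (S ⧸ (IsLocalRing.maximalIdeal R).map (algebraMap R S))
            ((IsLocalRing.maximalIdeal S).map
              (Ideal.Quotient.mk ((IsLocalRing.maximalIdeal R).map (algebraMap R S))))
            (n - i) := by
  have hle : (IsLocalRing.maximalIdeal R).map (algebraMap R S) ≤ IsLocalRing.maximalIdeal S :=
    ((IsLocalRing.local_hom_TFAE (algebraMap R S)).out 0 2).1 ‹_›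
  choose d hd e using exists_ext_quotient_map_linearEquiv S (IsLocalRing.maximalIdeal R)
  simp only [bassNumber_eq, hd]
  rw [length_ext_quotient_eq_sum hle d e n]
  push_cast
  rfl
end
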